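/- Let χ be a linear functional on W of height -1, 0 or 1 and let λ, λ' ∈ Λ(χ) with λ ∈ {0, p-1}. Then Ext(V_χ(λ'), V_χ(λ)), taken in the category of W-modules with p-character χ, is isomorphic to K if λ' ∈ {0, p-1, p-2, p-3, p-4, p-5}, and is 0 otherwise. -/

import Mathlib

/-!
Common setup: the Witt algebra `W` over `K` (char `p > 3`) has basis
`e_{-1}, e_0, ..., e_{p-2}` with `[e_i, e_j] = (j-i) e_{i+j}` (and `e_k = 0`
outside the range), and `p`-mapping `e_i^{[p]} = δ_{i0} e_i`.  A module with
`p`-character `χ` over `W` (resp. the subalgebra `W_0 = <e_0, ..., e_{p-2}>`)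
is given by a family of endomorphisms `ρ k` (`k : ℤ`, vanishing outside
`[lo, p-2]` where `lo = -1` for `W` and `lo = 0` for `W_0`) satisfying the
bracket relations and `(ρ i)^p - δ_{i0} ρ i = χ(e_i)^p • 1`.

The Baer Ext space `Ext(N, M)` of two such modules, in the category of
modules with `p`-character `χ`, is realized concretely: an extension
`0 → M → E → N → 0` admits a linear splitting `E ≃ M ⊕ N`, under which the
action of `e_k` is `(m, n) ↦ (ρM k m + c k n, ρN k n)` for a "cocycle"
`c : ℤ → (N →ₗ M)`; the conditions for `E` to be a module with `p`-character
`χ` are the cocycle conditions below, Baer equivalence corresponds to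
differing by a coboundary, and the Baer sum / scalar action correspond to the
linear structure on cocycles.  So `Ext(N, M) ≅ cocycles / coboundaries`.
-/

set_option maxHeartbeats 1000000
set_option synthInstance.maxHeartbeats 1000000

noncomputable section

/-- The coefficient `(-1)^j · (i!/(i-j)!) · ((j+1)λ - i + j)` of the action
`e_j · v_i = (coefficient) · v_{i-j}` on the reduced Verma module; it vanishes
for `j > i` since then `Nat.descFactorial i j = 0`. -/
def wCoef (K : Type) [Field K] (lam : K) (j i : ℕ) : K :=
  (-1 : K) ^ j * (Nat.descFactorial i j : K) * (((j : K) + 1) * lam - (i : K) + (j : K))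

/-- Matrices (in the basis `v_0, ..., v_{p-1}`) of the generators `e_j`
(`j : ℤ`) acting on the reduced Verma module `V_χ(λ)`; here `c = χ(e_{-1})^p`.
`e_{-1} v_i = v_{i+1}` for `i < p-1`, `e_{-1} v_{p-1} = c v_0`, and for
`0 ≤ j ≤ p-2`, `e_j v_i = (-1)^j (i!/(i-j)!) ((j+1)λ - i + j) v_{i-j}`. -/
def vermaMat (K : Type) [Field K] (p : ℕ) (c lam : K) : ℤ → Matrix (Fin p) (Fin p) K :=
  fun j =>
    if j = -1 then
      Matrix.of fun k l =>
        if (k : ℕ) = (l : ℕ) + 1 then 1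
        else if (k : ℕ) = 0 ∧ (l : ℕ) = p - 1 then c else 0
    else if 0 ≤ j ∧ j ≤ (p : ℤ) - 2 then
      Matrix.of fun k l =>
        if (l : ℕ) = (k : ℕ) + j.toNat then wCoef K lam j.toNat (l : ℕ) else 0
    else 0

/-- The action of the basis elements `e_j` (`j : ℤ`) on the reduced Verma
module `V_χ(λ)`, with `c = χ(e_{-1})^p`. -/
def vermaRho (K : Type) [Field K] (p : ℕ) (c lam : K) : ℤ → Module.End K (Fin p → K) :=
  fun j => Matrix.toLin' (vermaMat K p c lam j)

/-- The one-dimensional `W_0`-module `K_λ`: `e_0` acts by `λ`, all other `e_j` act by `0`. -/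
def oneDimRho (K : Type) [Field K] (lam : K) : ℤ → Module.End K K :=
  fun j => if j = 0 then lam • (1 : Module.End K K) else 0

/-- The one-dimensional trivial module: every basis element acts by `0`. -/
def trivRho (K : Type) [Field K] : ℤ → Module.End K K := fun _ => 0

/-- The coefficient `(-1)^(j+1) · ((i+1)!/(i-j)!)` of the action
`e_j · u_i = (coefficient) · u_{i-j}` on the `(p-1)`-dimensional simple module `S`. -/
def sCoef (K : Type) [Field K] (j i : ℕ) : K :=
  (-1 : K) ^ (j + 1) * (Nat.descFactorial (i + 1) (j + 1) : K)

/-- Matrices (in the basis `u_0, ..., u_{p-2}`) of the generators `e_j` acting on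
the `(p-1)`-dimensional simple restricted module `S = V_0(p-1)/Soc(V_0(p-1))`. -/
def sMat (K : Type) [Field K] (p : ℕ) : ℤ → Matrix (Fin (p - 1)) (Fin (p - 1)) K :=
  fun j =>
    if j = -1 then
      Matrix.of fun k l => if (k : ℕ) = (l : ℕ) + 1 then 1 else 0
    else if 0 ≤ j ∧ j ≤ (p : ℤ) - 2 then
      Matrix.of fun k l =>
        if (l : ℕ) = (k : ℕ) + j.toNat then sCoef K j.toNat (l : ℕ) else 0
    else 0

/-- The action of the basis elements `e_j` on the simple module `S`. -/
def sRho (K : Type) [Field K] (p : ℕ) : ℤ → Module.End K (Fin (p - 1) → K) :=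
  fun j => Matrix.toLin' (sMat K p j)

section ExtSpace

variable (K : Type) [Field K] (M N : Type) [AddCommGroup M] [Module K M]
  [AddCommGroup N] [Module K N]

/-- Constraint: a cocycle vanishes outside the index range `[lo, p-2]`. -/
def suppConstraint (p : ℕ) (lo k : ℤ) : (ℤ → N →ₗ[K] M) →ₗ[K] (N →ₗ[K] M) :=
  if k < lo ∨ (p : ℤ) - 2 < k then LinearMap.proj k else 0

variable {M N}

/-- Constraint on a cocycle coming from the bracket relation
`[e_i, e_j] = (j - i) e_{i+j}`:
`(j-i) c(i+j) = ρM i ∘ c j + c i ∘ ρN j - ρM j ∘ c i - c j ∘ ρN i`. -/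
def bracketConstraint (p : ℕ) (lo : ℤ) (ρM : ℤ → Module.End K M)
    (ρN : ℤ → Module.End K N) (i j : ℤ) :
    (ℤ → N →ₗ[K] M) →ₗ[K] (N →ₗ[K] M) :=
  if lo ≤ i ∧ i ≤ (p : ℤ) - 2 ∧ lo ≤ j ∧ j ≤ (p : ℤ) - 2 then
    ((j - i : ℤ) : K) • LinearMap.proj (i + j)
      - LinearMap.llcomp K N M M (ρM i) ∘ₗ LinearMap.proj j
      - LinearMap.lcomp K M (ρN j) ∘ₗ LinearMap.proj i
      + LinearMap.llcomp K N M M (ρM j) ∘ₗ LinearMap.proj i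
      + LinearMap.lcomp K M (ρN i) ∘ₗ LinearMap.proj j
  else 0

/-- Constraint on a cocycle expressing that the extension has `p`-character `χ`:
on the extension `E = M ⊕ N` the `(N → M)`-component of `(e_i)^p` is
`∑_{k<p} (ρM i)^k ∘ c i ∘ (ρN i)^(p-1-k)`, and this must agree with the
`(N → M)`-component of `e_i^{[p]} + χ(e_i)^p • 1`, which is `δ_{i0} c i`
(the scalar `χ(e_i)^p` contributes nothing off the diagonal, and the diagonal
blocks hold since `M`, `N` have `p`-character `χ`). -/
def pcharConstraint (p : ℕ) (lo : ℤ) (ρM : ℤ → Module.End K M)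
    (ρN : ℤ → Module.End K N) (i : ℤ) :
    (ℤ → N →ₗ[K] M) →ₗ[K] (N →ₗ[K] M) :=
  if lo ≤ i ∧ i ≤ (p : ℤ) - 2 then
    (∑ k ∈ Finset.range p,
        LinearMap.llcomp K N M M ((ρM i) ^ k) ∘ₗ
          LinearMap.lcomp K M ((ρN i) ^ (p - 1 - k)) ∘ₗ LinearMap.proj i)
      - (if i = 0 then (LinearMap.proj 0 : (ℤ → N →ₗ[K] M) →ₗ[K] (N →ₗ[K] M)) else 0)
  else 0

/-- The space of cocycles: families `c : ℤ → (N →ₗ M)` (the values of a linear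
map `W → Hom(N, M)` on the basis, `lo = -1` for `W` and `lo = 0` for `W_0`)
such that `M ⊕ N` with action `e_k (m, n) = (ρM k m + c k n, ρN k n)` is a
module with `p`-character `χ`. -/
def cocycles (p : ℕ) (lo : ℤ) (ρM : ℤ → Module.End K M) (ρN : ℤ → Module.End K N) :
    Submodule K (ℤ → N →ₗ[K] M) :=
  (⨅ k : ℤ, LinearMap.ker (suppConstraint K M N p lo k)) ⊓
    (⨅ i : ℤ, ⨅ j : ℤ, LinearMap.ker (bracketConstraint K p lo ρM ρN i j)) ⊓
    (⨅ i : ℤ, LinearMap.ker (pcharConstraint K p lo ρM ρN i))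

/-- The coboundaries: cocycles of the form `k ↦ ρM k ∘ f - f ∘ ρN k` for a
linear map `f : N → M`; these are exactly the cocycles of split extensions,
and two cocycles give Baer-equivalent extensions iff they differ by a
coboundary. -/
def coboundaries (p : ℕ) (lo : ℤ) (ρM : ℤ → Module.End K M) (ρN : ℤ → Module.End K N) :
    Submodule K (ℤ → N →ₗ[K] M) :=
  LinearMap.range (LinearMap.pi fun k : ℤ =>
    if lo ≤ k ∧ k ≤ (p : ℤ) - 2 then
      LinearMap.llcomp K N M M (ρM k) - LinearMap.lcomp K M (ρN k)
    else 0)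

/-- The Baer Ext space `Ext(N, M)` in the category of modules with
`p`-character `χ` (over `W` if `lo = -1`, over `W_0` if `lo = 0`), realized
as cocycles modulo coboundaries. -/
abbrev extSpace (p : ℕ) (lo : ℤ) (ρM : ℤ → Module.End K M) (ρN : ℤ → Module.End K N) :=
  (cocycles K p lo ρM ρN) ⧸
    (Submodule.comap (cocycles K p lo ρM ρN).subtype (coboundaries K p lo ρM ρN))

end ExtSpace

end


section WittVerma

variable {K : Type} [Field K] {p : ℕ} {c : K}

/-- The action of `e_{-1}` on a reduced Verma module; it does not depend on the weight. -/
def shiftOp (K : Type) [Field K] (p : ℕ) (c : K) : Module.End K (Fin p → K) :=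
  vermaRho K p c 0 (-1)

/-- The vector `e_{-1}^n v_0`. -/
def powVec (K : Type) [Field K] (p : ℕ) (c : K) (n : ℕ) : Fin p → K :=
  (shiftOp K p c ^ n) fun i => if (i : ℕ) = 0 then 1 else 0

/-- The action of `e_{n-1}` on the reduced Verma module. -/
def wittOp (K : Type) [Field K] (p : ℕ) (c lam : K) (n : ℕ) : Module.End K (Fin p → K) :=
  vermaRho K p c lam ((n : ℤ) - 1)

theorem wittOp_zero (lam : K) : wittOp K p c lam 0 = shiftOp K p c := by
  simp [wittOp, shiftOp, vermaRho, vermaMat]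

theorem wittOp_eq_zero (lam : K) {n : ℕ} (hn : p ≤ n) (hp : 0 < p) : wittOp K p c lam n = 0 := by
  have h1 : ¬ ((n : ℤ) - 1 = -1) := by omega
  have h2 : ¬ (0 ≤ (n : ℤ) - 1 ∧ (n : ℤ) - 1 ≤ (p : ℤ) - 2) := by omega
  simp only [wittOp, vermaRho, vermaMat, if_neg h1, if_neg h2, map_zero]

theorem shiftOp_powVec (n : ℕ) : shiftOp K p c (powVec K p c n) = powVec K p c (n + 1) := by
  simp [powVec, pow_succ']

theorem shiftOp_pow_powVec (m n : ℕ) :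
    (shiftOp K p c ^ m) (powVec K p c n) = powVec K p c (n + m) := by
  simp only [powVec, add_comm n m, pow_add, Module.End.mul_apply]

theorem shiftOp_indicator {n : ℕ} (hn : n < p) :
    shiftOp K p c (fun i : Fin p => if (i : ℕ) = n then 1 else 0) =
      fun i : Fin p =>
        if (i : ℕ) = n + 1 then 1 else if (i : ℕ) = 0 ∧ n = p - 1 then c else 0 := by
  ext i
  simp only [shiftOp, vermaRho, vermaMat, Matrix.toLin'_apply, Matrix.mulVec, dotProduct, if_true]
  rw [Finset.sum_eq_single (⟨n, hn⟩ : Fin p)]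
  · simp
  · intro b _ hb
    have : (b : ℕ) ≠ n := fun h => hb (Fin.ext h)
    simp [this]
  · simp

theorem powVec_eq {n : ℕ} (hn : n < p) :
    powVec K p c n = fun i : Fin p => if (i : ℕ) = n then 1 else 0 := by
  induction n with
  | zero => simp [powVec]
  | succ n ih =>
    rw [← shiftOp_powVec, ih (by omega), shiftOp_indicator (by omega)]
    ext i
    have : n ≠ p - 1 := by omega
    simp [this]

theorem powVec_eq_single (n : Fin p) : powVec K p c n = Pi.single n 1 := by
  rw [powVec_eq n.2]
  ext i
  simp [Pi.single_apply, Fin.ext_iff]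

theorem powVec_ne_zero {n : ℕ} (hn : n < p) : powVec K p c n ≠ 0 := by
  intro h
  have := congrFun h ⟨n, hn⟩
  simp [powVec_eq hn] at this

theorem powVec_self (hp : 0 < p) : powVec K p c p = c • powVec K p c 0 := by
  obtain ⟨q, rfl⟩ : ∃ q, p = q + 1 := ⟨p - 1, by omega⟩
  rw [← shiftOp_powVec, powVec_eq (by omega), powVec_eq hp, shiftOp_indicator (by omega)]
  ext i
  have : (i : ℕ) ≠ q + 1 := by omega
  simp [this]

theorem powVec_ext {M : Type} [AddCommGroup M] [Module K M] {f g : (Fin p → K) →ₗ[K] M}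
    (h : ∀ n < p, f (powVec K p c n) = g (powVec K p c n)) : f = g := by
  refine (Pi.basisFun K (Fin p)).ext fun i => ?_
  simpa [powVec_eq_single] using h i i.2

theorem exists_apply_powVec (u : ℕ → Fin p → K) :
    ∃ f : Module.End K (Fin p → K), ∀ n < p, f (powVec K p c n) = u n := by
  refine ⟨(Pi.basisFun K (Fin p)).constr K fun i => u i, fun n hn => ?_⟩
  have := (Pi.basisFun K (Fin p)).constr_basis K (fun i => u i) ⟨n, hn⟩
  rw [Pi.basisFun_apply, ← powVec_eq_single (c := c)] at this
  exact this

theorem shiftOp_pow_self (hp : 0 < p) : shiftOp K p c ^ p = c • 1 := by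
  refine powVec_ext (c := c) fun n _ => ?_
  rw [shiftOp_pow_powVec, add_comm, ← shiftOp_pow_powVec, powVec_self hp, map_smul,
    shiftOp_pow_powVec]
  simp

theorem eq_zero_of_commute_shiftOp {T : Module.End K (Fin p → K)}
    (hT : Commute (shiftOp K p c) T) (h0 : T (powVec K p c 0) = 0) : T = 0 := by
  refine powVec_ext (c := c) fun n _ => ?_
  have := congrArg (fun f : Module.End K (Fin p → K) => f (powVec K p c 0)) (hT.pow_left n).eq
  simp only [Module.End.mul_apply, h0, map_zero, shiftOp_pow_powVec, zero_add] at this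
  simp [← this]

theorem exists_commute_shiftOp (u : Fin p → K) :
    ∃ f : Module.End K (Fin p → K), Commute (shiftOp K p c) f ∧ f (powVec K p c 0) = u := by
  refine ⟨∑ i : Fin p, u i • shiftOp K p c ^ (i : ℕ), ?_, ?_⟩
  · exact Commute.sum_right _ _ _ fun i _ => ((Commute.refl _).pow_right _).smul_right _
  · ext k
    simp [LinearMap.sum_apply, shiftOp_pow_powVec, powVec_eq_single, Pi.single_apply]

theorem wittOp_succ_powVec_of_lt (lam : K) {j n : ℕ} (hj : j + 1 < p) (hn : n < p) :
    wittOp K p c lam (j + 1) (powVec K p c n) = wCoef K lam j n • powVec K p c (n - j) := by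
  have h1 : ¬ (((j + 1 : ℕ) : ℤ) - 1 = -1) := by omega
  have h2 : (0 ≤ ((j + 1 : ℕ) : ℤ) - 1 ∧ ((j + 1 : ℕ) : ℤ) - 1 ≤ (p : ℤ) - 2) := by omega
  have h3 : (((j + 1 : ℕ) : ℤ) - 1).toNat = j := by omega
  rw [powVec_eq (n := n - j) (by omega), powVec_eq hn]
  ext k
  simp only [wittOp, vermaRho, vermaMat, if_neg h1, if_pos h2, h3, Matrix.toLin'_apply,
    Matrix.mulVec, dotProduct]
  rw [Finset.sum_eq_single (⟨n, hn⟩ : Fin p)]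
  · by_cases hjn : j ≤ n
    · have : (n = k + j) ↔ ((k : ℕ) = n - j) := by omega
      simp [this]
    · have h4 : ¬ (n = k + j) := by omega
      have : n.descFactorial j = 0 := Nat.descFactorial_eq_zero_iff_lt.2 (by omega)
      simp [h4, wCoef, this]
  · intro b _ hb
    have : (b : ℕ) ≠ n := fun h => hb (Fin.ext h)
    simp [this]
  · simp

theorem wittOp_succ_powVec_zero (lam : K) (hp : 1 < p) (n : ℕ) :
    wittOp K p c lam (n + 1) (powVec K p c 0) = if n = 0 then lam • powVec K p c 0 else 0 := by
  by_cases hn : n + 1 < p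
  · rw [wittOp_succ_powVec_of_lt lam hn (by omega)]
    rcases n with _ | n <;> simp [wCoef]
  · rw [wittOp_eq_zero lam (by omega) (by omega), if_neg (by omega)]
    rfl

theorem wittOp_succ_powVec [CharP K p] (lam : K) {j n : ℕ} (hj : j + 1 < p) (hn : n ≤ p) :
    wittOp K p c lam (j + 1) (powVec K p c n) = wCoef K lam j n • powVec K p c (n - j) := by
  rcases hn.lt_or_eq with hn | rfl
  · exact wittOp_succ_powVec_of_lt lam hj hn
  · rw [powVec_self (by omega), map_smul, wittOp_succ_powVec_zero lam (by omega)]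
    rcases j with _ | j
    · simp [wCoef, powVec_self (show 0 < n by omega), smul_comm c lam]
    · have : ((n.descFactorial (j + 1) : ℕ) : K) = 0 := by
        rw [CharP.cast_eq_zero_iff K n]
        obtain ⟨q, rfl⟩ : ∃ q, n = q + 1 := ⟨n - 1, by omega⟩
        rw [Nat.succ_descFactorial_succ]
        exact dvd_mul_right _ _
      simp only [wCoef, this]
      simp

theorem wCoef_sub_wCoef_succ (lam : K) (j n : ℕ) :
    wCoef K lam (j + 1) n - wCoef K lam (j + 1) (n + 1) = ((j : K) + 2) * wCoef K lam j n := by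
  have h : ((n.descFactorial (j + 1) : ℕ) : K) = ((n : K) - j) * (n.descFactorial j : ℕ) := by
    rw [Nat.descFactorial_succ]
    rcases le_or_gt j n with hjn | hjn
    · push_cast [hjn]; ring
    · simp [Nat.descFactorial_eq_zero_iff_lt.2 hjn]
  simp only [wCoef, Nat.succ_descFactorial_succ, h]
  push_cast
  rw [pow_succ]
  ring

/-- The operator `∂` with `∂ (e_{-1}^n v_0) = n e_{-1}^{n-1} v_0`. -/
theorem exists_derivation [CharP K p] (hp : 1 < p) :
    ∃ D : Module.End K (Fin p → K), D (powVec K p c 0) = 0 ∧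
      D * shiftOp K p c - shiftOp K p c * D = 1 := by
  obtain ⟨D, hD⟩ := exists_apply_powVec (p := p) (c := c)
    fun n => (n : K) • powVec K p c (n - 1)
  have hD0 : D (powVec K p c 0) = 0 := by simp [hD 0 (by omega)]
  refine ⟨D, hD0, powVec_ext (c := c) fun n hn => ?_⟩
  have h1 : shiftOp K p c (D (powVec K p c n)) = (n : K) • powVec K p c n := by
    rw [hD n hn, map_smul, shiftOp_powVec]
    rcases n with _ | n <;> simp
  have h2 : D (powVec K p c (n + 1)) = ((n : K) + 1) • powVec K p c n := by
    rcases lt_or_eq_of_le (Nat.succ_le_of_lt hn) with h | h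
    · simp [hD _ h]
    · have : (n : K) + 1 = 0 := by
        rw [← Nat.cast_succ, h, CharP.cast_eq_zero]
      rw [this, ← Nat.succ_eq_add_one, h, powVec_self (by omega), map_smul, hD0]
      simp
  simp only [LinearMap.sub_apply, Module.End.mul_apply, h1, shiftOp_powVec, h2, Module.End.one_apply]
  module

theorem lie_shiftOp_wittOp [CharP K p] (lam : K) (hp : 1 < p) (n : ℕ) :
    ⁅shiftOp K p c, wittOp K p c lam n⁆ = n • wittOp K p c lam (n - 1) := by
  rw [Ring.lie_def]
  rcases n with _ | j
  · simp [wittOp_zero]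
  rcases lt_trichotomy (j + 1) p with hj | hj | hj
  · refine powVec_ext (c := c) fun n hn => ?_
    simp only [LinearMap.sub_apply, Module.End.mul_apply, LinearMap.smul_apply,
      shiftOp_powVec, wittOp_succ_powVec lam hj hn.le, wittOp_succ_powVec lam hj hn, map_smul]
    rcases j with _ | j
    · simp [wittOp_zero, shiftOp_powVec, wCoef]
      module
    · have h : wCoef K lam (j + 1) n • powVec K p c (n - (j + 1) + 1) =
          wCoef K lam (j + 1) n • powVec K p c (n - j) := by
        rcases le_or_gt (j + 1) n with h | h
        · rw [show n - (j + 1) + 1 = n - j by omega]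
        · simp [wCoef, Nat.descFactorial_eq_zero_iff_lt.2 h, -Nat.descFactorial_succ]
      rw [Nat.add_sub_cancel, wittOp_succ_powVec lam (by omega) hn.le, h,
        Nat.succ_sub_succ, ← sub_smul, Nat.succ_eq_add_one, wCoef_sub_wCoef_succ,
        ← Nat.cast_smul_eq_nsmul K, smul_smul]
      push_cast
      congr 2
      ring
  · rw [wittOp_eq_zero lam hj.ge (by omega), hj, ← Nat.cast_smul_eq_nsmul K,
      CharP.cast_eq_zero]
    simp
  · rw [wittOp_eq_zero lam hj.le (by omega), wittOp_eq_zero lam (by omega) (by omega)]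
    simp

end WittVerma

section BlockTriangular

attribute [local instance] LieRing.ofAssociativeRing

/-- If `ad (E 0)` lowers the index as in the Witt algebra, then the Witt relations hold as soon as
their defects vanish whenever they commute with `E 0`. -/
theorem witt_relations_of_commute {R : Type} [Ring R] (E : ℕ → R)
    (h0 : ∀ n, ⁅E 0, E n⁆ = n • E (n - 1))
    (hE : ∀ m n, Commute (E 0) (⁅E (m + 1), E (n + 1)⁆ - ((n : ℤ) - m) • E (m + n + 1)) →
      ⁅E (m + 1), E (n + 1)⁆ - ((n : ℤ) - m) • E (m + n + 1) = 0) (m n : ℕ) :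
    ⁅E m, E n⁆ = ((n : ℤ) - m) • E (m + n - 1) := by
  induction hs : m + n generalizing m n with
  | zero =>
    obtain ⟨rfl, rfl⟩ : m = 0 ∧ n = 0 := by omega
    simp
  | succ s ih =>
    rcases m with _ | m
    · rw [h0, ← hs, zero_add]
      simp
    rcases n with _ | n
    · rw [← lie_skew, h0, ← hs, add_zero, ← natCast_zsmul, ← neg_smul]
      simp
    have key := hE m n ?_
    · rw [← hs, show m + 1 + (n + 1) - 1 = m + n + 1 by omega, sub_eq_zero.1 key]
      congr 1
      push_cast
      ring
    · rw [commute_iff_lie_eq, lie_sub, leibniz_lie, lie_zsmul, h0, h0, h0, nsmul_lie, lie_nsmul,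
        Nat.add_sub_cancel, Nat.add_sub_cancel, Nat.add_sub_cancel, ih _ _ (by omega),
        ih _ _ (by omega), show s - 1 = m + n by omega]
      push_cast
      module

/-- In a `K`-algebra in characteristic `p`, `ad (x ^ p) = (ad x) ^ p`. -/
theorem lie_pow_char {K A : Type} [Field K] {p : ℕ} [CharP K p] (hp : p ≠ 0) [Ring A] [Algebra K A]
    (x y : A) : ⁅x ^ p, y⁆ = ((LieAlgebra.ad K A x) ^ p) y := by
  nontriviality A
  have : Fact p.Prime := ⟨(CharP.char_is_prime_or_zero K p).resolve_right hp⟩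
  have : CharP (Module.End K A) p :=
    charP_of_injective_algebraMap (algebraMap K (Module.End K A)).injective p
  rw [LieAlgebra.ad_eq_lmul_left_sub_lmul_right]
  rw [Pi.sub_apply, sub_pow_char_of_commute _ (LinearMap.commute_mulLeft_right x x)]
  simp [LinearMap.pow_mulLeft, LinearMap.pow_mulRight, Ring.lie_def]

theorem ad_pow_apply_witt {K A : Type} [Field K] [Ring A] [Algebra K A] {E : ℕ → A}
    (hE : ∀ m n, ⁅E m, E n⁆ = ((n : ℤ) - m) • E (m + n - 1)) (n k : ℕ) :
    ∃ t : ℤ, ((LieAlgebra.ad K A (E (n + 1))) ^ k) (E 0) = t • E (k * n) := by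
  induction k with
  | zero => exact ⟨1, by simp⟩
  | succ k ih =>
    obtain ⟨t, ht⟩ := ih
    refine ⟨t * ((k * n : ℕ) - (n + 1 : ℕ)), ?_⟩
    rw [pow_succ', Module.End.mul_apply, ht, map_zsmul, LieAlgebra.ad_apply, hE, smul_smul,
      show n + 1 + k * n - 1 = (k + 1) * n by rw [Nat.succ_mul]; omega]

variable {A : Type} [Ring A]

theorem blockTriangular_pow (a b d : A) (n : ℕ) :
    (!![a, b; 0, d]) ^ n =
      !![a ^ n, ∑ k ∈ Finset.range n, a ^ k * b * d ^ (n - 1 - k); 0, d ^ n] := by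
  induction n with
  | zero => simp [Matrix.one_fin_two]
  | succ n ih =>
    rw [pow_succ, ih, Matrix.mul_fin_two, Finset.sum_range_succ]
    have : ∑ k ∈ Finset.range n, a ^ k * b * d ^ (n + 1 - 1 - k) =
        (∑ k ∈ Finset.range n, a ^ k * b * d ^ (n - 1 - k)) * d := by
      rw [Finset.sum_mul]
      refine Finset.sum_congr rfl fun k hk => ?_
      rw [Finset.mem_range] at hk
      rw [mul_assoc _ _ d, ← pow_succ, show n - 1 - k + 1 = n + 1 - 1 - k by omega]
    rw [this]
    simp [pow_succ, add_comm]

end BlockTriangular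

section BlockCocycle

attribute [local instance] LieRing.ofAssociativeRing

section

variable {A : Type} [Ring A]

theorem blockTriangular_lie (a b d a' b' d' : A) :
    ⁅(!![a, b; 0, d] : Matrix (Fin 2) (Fin 2) A), !![a', b'; 0, d']⁆ =
      !![⁅a, a'⁆, a * b' + b * d' - (a' * b + b' * d); 0, ⁅d, d'⁆] := by
  rw [Ring.lie_def, Matrix.mul_fin_two, Matrix.mul_fin_two]
  ext i j
  fin_cases i <;> fin_cases j <;> simp [Ring.lie_def]

theorem blockTriangular_commute {x a b d : A}
    (h : Commute (!![x, 0; 0, x] : Matrix (Fin 2) (Fin 2) A) !![a, b; 0, d]) :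
    Commute x a ∧ Commute x b ∧ Commute x d := by
  have h := h.eq
  rw [Matrix.mul_fin_two, Matrix.mul_fin_two] at h
  have h1 := congrFun (congrFun h 0) 0
  have h2 := congrFun (congrFun h 0) 1
  have h3 := congrFun (congrFun h 1) 1
  simp at h1 h2 h3
  exact ⟨h1, h2, h3⟩

end

variable {K : Type} [Field K] {p : ℕ} {c : K}

/-- The cocycles of `W` with values in `Hom(V_χ(λ'), V_χ(λ))`, with indices shifted by one so
that they start at `0`. -/
structure IsWittCocycle (c lam lam' : K) (C : ℕ → Module.End K (Fin p → K)) : Prop where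
  eq_zero : ∀ n, p ≤ n → C n = 0
  bracket : ∀ m n, m < p → n < p → ((n : ℤ) - m) • C (m + n - 1) =
    wittOp K p c lam m * C n + C m * wittOp K p c lam' n -
      (wittOp K p c lam n * C m + C n * wittOp K p c lam' m)
  pchar : ∀ n < p, ∑ k ∈ Finset.range p,
    wittOp K p c lam n ^ k * C n * wittOp K p c lam' n ^ (p - 1 - k) = if n = 1 then C 1 else 0

theorem wittOp_lie_apply_powVec_zero [CharP K p] (lam : K) (hp : 1 < p) (m n : ℕ) :
    (⁅wittOp K p c lam (m + 1), wittOp K p c lam (n + 1)⁆ -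
      ((n : ℤ) - m) • wittOp K p c lam (m + n + 1)) (powVec K p c 0) = 0 := by
  simp only [Ring.lie_def, LinearMap.sub_apply, Module.End.mul_apply, LinearMap.smul_apply,
    wittOp_succ_powVec_zero lam hp]
  rcases m with _ | m <;> rcases n with _ | n <;>
    simp [wittOp_succ_powVec_zero lam hp, ← add_assoc]

theorem blockTriangular_witt_relations [CharP K p] {lam lam' : K} (hp : 1 < p)
    {C : ℕ → Module.End K (Fin p → K)} (hC0 : C 0 = 0)
    (hC : ∀ n, ⁅shiftOp K p c, C n⁆ = n • C (n - 1))
    (hv : ∀ m n, (wittOp K p c lam (m + 1) * C (n + 1) + C (m + 1) * wittOp K p c lam' (n + 1) -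
      (wittOp K p c lam (n + 1) * C (m + 1) + C (n + 1) * wittOp K p c lam' (m + 1)))
        (powVec K p c 0) = ((n : ℤ) - m) • C (m + n + 1) (powVec K p c 0)) (m n : ℕ) :
    ⁅(!![wittOp K p c lam m, C m; 0, wittOp K p c lam' m] : Matrix (Fin 2) (Fin 2) _),
      !![wittOp K p c lam n, C n; 0, wittOp K p c lam' n]⁆ = ((n : ℤ) - m) •
        !![wittOp K p c lam (m + n - 1), C (m + n - 1); 0, wittOp K p c lam' (m + n - 1)] := by
  refine witt_relations_of_commute (fun n =>
    (!![wittOp K p c lam n, C n; 0, wittOp K p c lam' n] : Matrix (Fin 2) (Fin 2) _)) ?_ ?_ m n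
  · intro n
    have := hC n
    rw [Ring.lie_def] at this
    rw [blockTriangular_lie, wittOp_zero, wittOp_zero, lie_shiftOp_wittOp _ hp,
      lie_shiftOp_wittOp _ hp]
    ext i j : 1
    fin_cases i <;> fin_cases j <;> simp [hC0, this]
  · intro m n h
    have hB : ⁅(!![wittOp K p c lam (m + 1), C (m + 1); 0, wittOp K p c lam' (m + 1)] :
          Matrix (Fin 2) (Fin 2) _),
        !![wittOp K p c lam (n + 1), C (n + 1); 0, wittOp K p c lam' (n + 1)]⁆ - ((n : ℤ) - m) •
        !![wittOp K p c lam (m + n + 1), C (m + n + 1); 0, wittOp K p c lam' (m + n + 1)] =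
        !![⁅wittOp K p c lam (m + 1), wittOp K p c lam (n + 1)⁆ -
              ((n : ℤ) - m) • wittOp K p c lam (m + n + 1),
            wittOp K p c lam (m + 1) * C (n + 1) + C (m + 1) * wittOp K p c lam' (n + 1) -
              (wittOp K p c lam (n + 1) * C (m + 1) + C (n + 1) * wittOp K p c lam' (m + 1)) -
              ((n : ℤ) - m) • C (m + n + 1);
          0, ⁅wittOp K p c lam' (m + 1), wittOp K p c lam' (n + 1)⁆ -
              ((n : ℤ) - m) • wittOp K p c lam' (m + n + 1)] := by
      rw [blockTriangular_lie]
      ext i j : 1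
      fin_cases i <;> fin_cases j <;> simp
    simp only [hB, wittOp_zero, hC0] at h ⊢
    obtain ⟨h1, h2, h3⟩ := blockTriangular_commute h
    rw [eq_zero_of_commute_shiftOp h1 (wittOp_lie_apply_powVec_zero lam hp m n),
      eq_zero_of_commute_shiftOp h3 (wittOp_lie_apply_powVec_zero lam' hp m n),
      eq_zero_of_commute_shiftOp h2]
    · ext i j : 1
      fin_cases i <;> fin_cases j <;> rfl
    · rw [LinearMap.sub_apply, hv, LinearMap.smul_apply, sub_self]

theorem blockTriangular_pow_commute [CharP K p] {lam lam' : K} (hp : 1 < p)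
    {C : ℕ → Module.End K (Fin p → K)} (hC0 : C 0 = 0) (hCp : ∀ n, p ≤ n → C n = 0)
    (hE : ∀ m n, ⁅(!![wittOp K p c lam m, C m; 0, wittOp K p c lam' m] :
        Matrix (Fin 2) (Fin 2) _),
      !![wittOp K p c lam n, C n; 0, wittOp K p c lam' n]⁆ = ((n : ℤ) - m) •
        !![wittOp K p c lam (m + n - 1), C (m + n - 1); 0, wittOp K p c lam' (m + n - 1)])
    (n : ℕ) :
    Commute (shiftOp K p c) (wittOp K p c lam (n + 2) ^ p) ∧
    Commute (shiftOp K p c) (∑ k ∈ Finset.range p,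
      wittOp K p c lam (n + 2) ^ k * C (n + 2) * wittOp K p c lam' (n + 2) ^ (p - 1 - k)) := by
  obtain ⟨t, ht⟩ := ad_pow_apply_witt (K := K) (E := fun n =>
    (!![wittOp K p c lam n, C n; 0, wittOp K p c lam' n] : Matrix (Fin 2) (Fin 2) _)) hE (n + 1) p
  have hpn : p ≤ p * (n + 1) := Nat.le_mul_of_pos_right p (by omega)
  have hz : (!![(0 : Module.End K (Fin p → K)), 0; 0, 0] : Matrix (Fin 2) (Fin 2) _) = 0 := by
    ext i j : 1
    fin_cases i <;> fin_cases j <;> rfl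
  rw [← lie_pow_char (by omega), wittOp_eq_zero lam hpn (by omega), hCp _ hpn,
    wittOp_eq_zero lam' hpn (by omega), hz, smul_zero, ← commute_iff_lie_eq, hC0, wittOp_zero,
    wittOp_zero, blockTriangular_pow] at ht
  obtain ⟨h1, h2, -⟩ := blockTriangular_commute ht.symm
  exact ⟨h1, h2⟩

theorem wittOp_pow_powVec_eq_zero [CharP K p] (lam : K) (n : ℕ) {k m : ℕ} (hm : m < p)
    (hk : m < k) : (wittOp K p c lam (n + 2) ^ k) (powVec K p c m) = 0 := by
  induction k generalizing m with
  | zero => omega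
  | succ k ih =>
    rw [pow_succ, Module.End.mul_apply]
    rcases lt_or_ge (n + 2) p with h | h
    · rw [wittOp_succ_powVec_of_lt lam h hm, map_smul]
      rcases lt_or_ge m (n + 1) with h' | h'
      · simp [wCoef, Nat.descFactorial_eq_zero_iff_lt.2 h', -Nat.descFactorial_succ]
      · rw [ih (by omega) (by omega), smul_zero]
    · simp [wittOp_eq_zero lam h (by omega)]

theorem wittOp_zero_weight_pow_powVec [CharP K p] (n : ℕ) {k m : ℕ} (hm : m < p)
    (hk : m ≤ k + 1) : (wittOp K p c 0 (n + 2) ^ (k + 1)) (powVec K p c m) = 0 := by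
  induction k generalizing m with
  | zero =>
    rw [zero_add, pow_one]
    rcases lt_or_ge (n + 2) p with h | h
    · rw [wittOp_succ_powVec_of_lt (0 : K) h hm]
      rcases lt_or_ge m (n + 1) with h' | h'
      · simp [wCoef, Nat.descFactorial_eq_zero_iff_lt.2 h', -Nat.descFactorial_succ]
      · obtain ⟨rfl, rfl⟩ : m = 1 ∧ n = 0 := by omega
        simp [wCoef]
    · simp [wittOp_eq_zero (0 : K) h (show 0 < p by omega)]
  | succ k ih =>
    rw [pow_succ, Module.End.mul_apply]
    rcases lt_or_ge (n + 2) p with h | h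
    · rw [wittOp_succ_powVec_of_lt (0 : K) h hm, map_smul, ih (by omega) (by omega), smul_zero]
    · simp [wittOp_eq_zero (0 : K) h (show 0 < p by omega)]

theorem wCoef_neg_one_pred [CharP K p] (hp : 0 < p) (j : ℕ) : wCoef K (-1) j (p - 1) = 0 := by
  have : ((p - 1 : ℕ) : K) = -1 := by
    rw [Nat.cast_sub (by omega), CharP.cast_eq_zero]
    simp
  simp [wCoef, this]

theorem wittOp_pow_pred_powVec [CharP K p] {lam : K} (hp : 2 < p) (hl : lam = 0 ∨ lam = -1)
    (n : ℕ) {m : ℕ} (hm : m < p) :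
    (wittOp K p c lam (n + 2) ^ (p - 1)) (powVec K p c m) = 0 := by
  rcases lt_or_ge m (p - 1) with h | h
  · exact wittOp_pow_powVec_eq_zero lam n hm h
  rcases hl with rfl | rfl
  · obtain ⟨q, rfl⟩ : ∃ q, p = q + 2 := ⟨p - 2, by omega⟩
    exact wittOp_zero_weight_pow_powVec n hm (by omega)
  · obtain rfl : m = p - 1 := by omega
    rw [← Nat.sub_add_cancel (show 1 ≤ p - 1 by omega), pow_succ, Module.End.mul_apply,
      Nat.sub_add_cancel (by omega)]
    rcases lt_or_ge (n + 2) p with h' | h'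
    · rw [wittOp_succ_powVec_of_lt _ h' hm, wCoef_neg_one_pred (by omega)]
      simp
    · simp [wittOp_eq_zero _ h' (show 0 < p by omega)]

theorem wittOp_add_two_pow_char [CharP K p] (lam : K) (n : ℕ) :
    wittOp K p c lam (n + 2) ^ p = 0 :=
  powVec_ext (c := c) fun m hm => by
    rw [wittOp_pow_powVec_eq_zero lam n hm hm, LinearMap.zero_apply]

theorem wittOp_one_powVec (lam : K) {n : ℕ} (hp : 1 < p) (hn : n < p) :
    wittOp K p c lam 1 (powVec K p c n) = (lam - n) • powVec K p c n := by
  rw [← zero_add 1, wittOp_succ_powVec_of_lt lam (by omega) hn]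
  simp [wCoef]

theorem wittOp_one_pow_powVec (lam : K) {n : ℕ} (hp : 1 < p) (hn : n < p) (k : ℕ) :
    (wittOp K p c lam 1 ^ k) (powVec K p c n) = (lam - n) ^ k • powVec K p c n := by
  induction k with
  | zero => simp
  | succ k ih =>
    rw [pow_succ, Module.End.mul_apply, wittOp_one_powVec lam hp hn, map_smul, ih, smul_smul,
      pow_succ']

theorem wittOp_one_pow_char [CharP K p] {lam : K} (hp : 1 < p) (hlam : lam ^ p = lam) :
    wittOp K p c lam 1 ^ p = wittOp K p c lam 1 := by
  have : Fact p.Prime := ⟨(CharP.char_is_prime_or_zero K p).resolve_right (by omega)⟩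
  refine powVec_ext (c := c) fun n hn => ?_
  rw [wittOp_one_pow_powVec lam hp hn, wittOp_one_powVec lam hp hn, sub_pow_char, hlam,
    ← frobenius_def, map_natCast]

/-- A cochain commuting with the shift up to lower terms is a cocycle as soon as its values on
the generator `v_0` satisfy the cocycle conditions. -/
theorem isWittCocycle_of_apply_powVec_zero [CharP K p] {lam lam' : K} (hp : 1 < p)
    {C : ℕ → Module.End K (Fin p → K)} (hC0 : C 0 = 0) (hC1 : C 1 = 0)
    (hCp : ∀ n, p ≤ n → C n = 0)
    (hC : ∀ n, ⁅shiftOp K p c, C n⁆ = n • C (n - 1))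
    (hv : ∀ m n, (wittOp K p c lam (m + 1) * C (n + 1) + C (m + 1) * wittOp K p c lam' (n + 1) -
      (wittOp K p c lam (n + 1) * C (m + 1) + C (n + 1) * wittOp K p c lam' (m + 1)))
        (powVec K p c 0) = ((n : ℤ) - m) • C (m + n + 1) (powVec K p c 0))
    (hpow : ∀ n, (wittOp K p c lam (n + 2) ^ (p - 1)) (C (n + 2) (powVec K p c 0)) = 0) :
    IsWittCocycle c lam lam' C := by
  have hE := blockTriangular_witt_relations hp hC0 hC hv
  refine ⟨hCp, fun m n _ _ => ?_, fun n _ => ?_⟩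
  · have := congrFun (congrFun (hE m n) 0) 1
    rw [blockTriangular_lie] at this
    simpa using this.symm
  · rcases n with _ | _ | n
    · simp [hC0]
    · simp [hC1]
    · rw [if_neg (by omega)]
      refine eq_zero_of_commute_shiftOp
        (blockTriangular_pow_commute hp hC0 hCp hE n).2 ?_
      rw [LinearMap.sum_apply]
      refine Finset.sum_eq_zero fun k hk => ?_
      rw [Finset.mem_range] at hk
      simp only [Module.End.mul_apply]
      rcases eq_or_ne k (p - 1) with rfl | h
      · simp only [Nat.sub_self, pow_zero, Module.End.one_apply]
        exact hpow n
      · rw [wittOp_pow_powVec_eq_zero lam' n (by omega) (show 0 < p - 1 - k by omega), map_zero,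
          map_zero]

theorem wittOp_lie [CharP K p] (lam : K) (hp : 1 < p) (m n : ℕ) :
    ⁅wittOp K p c lam m, wittOp K p c lam n⁆ =
      ((n : ℤ) - m) • wittOp K p c lam (m + n - 1) := by
  have := blockTriangular_witt_relations (c := c) (lam := lam) (lam' := lam) hp
    (C := fun _ => 0) rfl (by simp) (by simp) m n
  rw [blockTriangular_lie] at this
  simpa using congrFun (congrFun this 0) 0

theorem sum_pow_mul_sub_mul_pow {A : Type} [Ring A] (a b f : A) (n : ℕ) :
    ∑ k ∈ Finset.range n, a ^ k * (a * f - f * b) * b ^ (n - 1 - k) = a ^ n * f - f * b ^ n := by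
  have := Finset.sum_range_sub (fun k => a ^ k * f * b ^ (n - k)) n
  simp only [Nat.sub_self, pow_zero, mul_one, one_mul, Nat.sub_zero] at this
  rw [← this]
  refine Finset.sum_congr rfl fun k hk => ?_
  rw [Finset.mem_range] at hk
  rw [show n - (k + 1) = n - 1 - k by omega, show n - k = n - 1 - k + 1 by omega, pow_succ a,
    pow_succ' b]
  noncomm_ring

theorem lie_mul_sub_mul_lie {A : Type} [Ring A] (a b f a' b' : A) :
    ⁅a, b⁆ * f - f * ⁅a', b'⁆ = a * (b * f - f * b') + (a * f - f * a') * b' -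
      (b * (a * f - f * a') + (b * f - f * b') * a') := by
  simp only [Ring.lie_def]
  noncomm_ring

theorem isWittCocycle_coboundary [CharP K p] {lam lam' : K} (hp : 1 < p) (hlam : lam ^ p = lam)
    (hlam' : lam' ^ p = lam') (f : Module.End K (Fin p → K)) :
    IsWittCocycle c lam lam' fun n => wittOp K p c lam n * f - f * wittOp K p c lam' n := by
  refine ⟨fun n hn => ?_, fun m n _ _ => ?_, fun n _ => ?_⟩
  · simp [wittOp_eq_zero _ hn (show 0 < p by omega)]
  · rw [smul_sub, ← smul_mul_assoc, ← mul_smul_comm, ← wittOp_lie lam hp, ← wittOp_lie lam' hp,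
      lie_mul_sub_mul_lie]
  · rw [sum_pow_mul_sub_mul_pow]
    rcases n with _ | _ | n
    · simp [wittOp_zero, shiftOp_pow_self (show 0 < p by omega)]
    · simp [wittOp_one_pow_char hp hlam, wittOp_one_pow_char hp hlam']
    · simp [wittOp_add_two_pow_char]

theorem intCast_sub_smul_apply_sub_one {M : Type} [AddCommGroup M] [Module K M] (C : ℤ → M)
    (m n : ℕ) : ((((n : ℤ) - 1 - ((m : ℤ) - 1) : ℤ)) : K) • C ((m : ℤ) - 1 + ((n : ℤ) - 1)) =
      ((n : ℤ) - m) • C (((m + n - 1 : ℕ) : ℤ) - 1) := by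
  rw [Int.cast_smul_eq_zsmul, sub_sub_sub_cancel_right]
  rcases Nat.eq_zero_or_pos (m + n) with h | h
  · obtain ⟨rfl, rfl⟩ : m = 0 ∧ n = 0 := by omega
    simp
  · congr 2
    omega

theorem bracketConstraint_apply_sub_one {lam lam' : K} {C : ℤ → Module.End K (Fin p → K)}
    {m n : ℕ} (hm : m < p) (hn : n < p) :
    bracketConstraint K p (-1) (vermaRho K p c lam) (vermaRho K p c lam')
        ((m : ℤ) - 1) ((n : ℤ) - 1) C =
      ((n : ℤ) - m) • C (((m + n - 1 : ℕ) : ℤ) - 1) -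
        (wittOp K p c lam m * C ((n : ℤ) - 1) + C ((m : ℤ) - 1) * wittOp K p c lam' n -
        (wittOp K p c lam n * C ((m : ℤ) - 1) + C ((n : ℤ) - 1) * wittOp K p c lam' m)) := by
  rw [bracketConstraint, if_pos (by omega), ← intCast_sub_smul_apply_sub_one (K := K)]
  simp only [LinearMap.add_apply, LinearMap.sub_apply, LinearMap.smul_apply, LinearMap.comp_apply,
    LinearMap.proj_apply, wittOp, Module.End.mul_eq_comp]
  refine LinearMap.ext fun v => ?_
  simp [LinearMap.llcomp_apply, LinearMap.lcomp_apply]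
  abel

theorem pcharConstraint_apply_sub_one {lam lam' : K} {C : ℤ → Module.End K (Fin p → K)}
    {n : ℕ} (hn : n < p) :
    pcharConstraint K p (-1) (vermaRho K p c lam) (vermaRho K p c lam') ((n : ℤ) - 1) C =
      ∑ k ∈ Finset.range p, wittOp K p c lam n ^ k * C ((n : ℤ) - 1) *
        wittOp K p c lam' n ^ (p - 1 - k) - if n = 1 then C 0 else 0 := by
  rw [pcharConstraint, if_pos (by omega)]
  have h : (n : ℤ) - 1 = 0 ↔ n = 1 := by omega
  simp only [h, LinearMap.sub_apply, LinearMap.sum_apply]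
  congr 1
  split_ifs <;> simp

theorem mem_cocycles_iff_isWittCocycle {lam lam' : K} {C : ℤ → Module.End K (Fin p → K)} :
    C ∈ cocycles K p (-1) (vermaRho K p c lam) (vermaRho K p c lam') ↔
      (∀ k < -1, C k = 0) ∧ IsWittCocycle c lam lam' fun n => C ((n : ℤ) - 1) := by
  simp only [cocycles, Submodule.mem_inf, Submodule.mem_iInf, LinearMap.mem_ker]
  constructor
  · rintro ⟨⟨h1, h2⟩, h3⟩
    refine ⟨fun k hk => ?_, fun n hn => ?_, fun m n hm hn => ?_, fun n hn => ?_⟩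
    · simpa [suppConstraint, hk] using h1 k
    · have : (p : ℤ) - 2 < (n : ℤ) - 1 := by omega
      simpa [suppConstraint, this] using h1 ((n : ℤ) - 1)
    · rw [← sub_eq_zero, ← bracketConstraint_apply_sub_one hm hn, h2]
    · have := h3 ((n : ℤ) - 1)
      rw [pcharConstraint_apply_sub_one hn, sub_eq_zero] at this
      simpa using this
  · rintro ⟨h0, h1, h2, h3⟩
    refine ⟨⟨fun k => ?_, fun i j => ?_⟩, fun i => ?_⟩
    · rw [suppConstraint]
      split_ifs with h
      · rcases h with h | h
        · exact h0 k h
        · rcases lt_or_ge k (-1) with h' | h'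
          · exact h0 k h'
          · lift k + 1 to ℕ using by omega with n hn
            have := h1 n (by omega)
            rwa [hn, add_sub_cancel_right] at this
      · rfl
    · by_cases h : -1 ≤ i ∧ i ≤ (p : ℤ) - 2 ∧ -1 ≤ j ∧ j ≤ (p : ℤ) - 2
      · obtain ⟨m, hm⟩ : ∃ m : ℕ, i = m - 1 := ⟨(i + 1).toNat, by omega⟩
        obtain ⟨n, hn⟩ : ∃ n : ℕ, j = n - 1 := ⟨(j + 1).toNat, by omega⟩
        subst hm hn
        rw [bracketConstraint_apply_sub_one (by omega) (by omega), sub_eq_zero]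
        exact h2 m n (by omega) (by omega)
      · rw [bracketConstraint, if_neg h, LinearMap.zero_apply]
    · by_cases h : -1 ≤ i ∧ i ≤ (p : ℤ) - 2
      · obtain ⟨n, hn⟩ : ∃ n : ℕ, i = n - 1 := ⟨(i + 1).toNat, by omega⟩
        subst hn
        rw [pcharConstraint_apply_sub_one (by omega), sub_eq_zero]
        simpa using h3 n (by omega)
      · rw [pcharConstraint, if_neg h, LinearMap.zero_apply]

theorem mem_coboundaries_iff {lam lam' : K} (hp : 0 < p) {C : ℤ → Module.End K (Fin p → K)} :
    C ∈ coboundaries K p (-1) (vermaRho K p c lam) (vermaRho K p c lam') ↔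
      (∀ k < -1, C k = 0) ∧ ∃ f, ∀ n : ℕ, C ((n : ℤ) - 1) =
        wittOp K p c lam n * f - f * wittOp K p c lam' n := by
  rw [coboundaries, LinearMap.mem_range]
  constructor
  · rintro ⟨f, rfl⟩
    refine ⟨fun k hk => ?_, f, fun n => ?_⟩
    · rw [LinearMap.pi_apply, if_neg (by omega), LinearMap.zero_apply]
    · rw [LinearMap.pi_apply]
      split_ifs with h
      · rfl
      · rw [wittOp_eq_zero _ (by omega) hp, wittOp_eq_zero _ (by omega) hp]
        simp
  · rintro ⟨h0, f, hf⟩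
    refine ⟨f, ?_⟩
    ext1 k
    rw [LinearMap.pi_apply]
    rcases lt_or_ge k (-1) with h' | h'
    · rw [if_neg (by omega), h0 k h', LinearMap.zero_apply]
    · obtain ⟨n, hn⟩ : ∃ n : ℕ, k = n - 1 := ⟨(k + 1).toNat, by omega⟩
      subst hn
      rw [hf]
      split_ifs with h
      · rfl
      · rw [wittOp_eq_zero _ (by omega) hp, wittOp_eq_zero _ (by omega) hp]
        simp

theorem coboundaries_le_cocycles [CharP K p] {lam lam' : K} (hp : 1 < p) (hlam : lam ^ p = lam)
    (hlam' : lam' ^ p = lam') :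
    coboundaries K p (-1) (vermaRho K p c lam) (vermaRho K p c lam') ≤
      cocycles K p (-1) (vermaRho K p c lam) (vermaRho K p c lam') := by
  intro C hC
  rw [mem_coboundaries_iff (by omega)] at hC
  obtain ⟨h0, f, hf⟩ := hC
  rw [mem_cocycles_iff_isWittCocycle, funext hf]
  exact ⟨h0, isWittCocycle_coboundary hp hlam hlam' f⟩

end BlockCocycle

section ExtCoefficients

attribute [local instance] LieRing.ofAssociativeRing

variable {K : Type} [Field K] {p : ℕ} {c : K}

/-- The representative of `d - j` modulo `p` used for a weight vector of degree `d - j`. -/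
def extWeight (p d j : ℕ) : ℕ := if j ≤ d then d - j else d + p - j

theorem extWeight_lt {d : ℕ} (hd : d < p) (j : ℕ) : extWeight p d j < p := by
  rw [extWeight]
  split_ifs <;> omega

theorem cast_extWeight [CharP K p] {d j : ℕ} (hj : j ≤ p) :
    (extWeight p d j : K) = (d : K) - j := by
  rw [extWeight]
  split_ifs with h
  · rw [Nat.cast_sub h]
  · rw [Nat.cast_sub (by omega), Nat.cast_add, CharP.cast_eq_zero K p, add_zero]

/-- The cocycle equations for a normalized cocycle `e_j ↦ a_j v_{d - j}` on the generator. -/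
structure IsExtSolution (p : ℕ) (lam : K) (d : ℕ) (a : ℕ → K) : Prop where
  eq_zero : ∀ j, p ≤ j + 1 → a j = 0
  rel : ∀ i j, 1 ≤ i → 1 ≤ j → i + 1 < p → j + 1 < p →
    a j * wCoef K lam i (extWeight p d j) - a i * wCoef K lam j (extWeight p d i) =
      ((j : K) - i) * a (i + j)

/-- `C` is a cocycle vanishing on `e_{-1}` and `e_0` with `C (e_j) v_0 = a_j v_{d - j}`. -/
structure HasExtCoeffs (c lam lam' : K) (d : ℕ) (C : ℤ → Module.End K (Fin p → K))
    (a : ℕ → K) : Prop where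
  mem : C ∈ cocycles K p (-1) (vermaRho K p c lam) (vermaRho K p c lam')
  neg_one : C (-1) = 0
  zero : C 0 = 0
  apply : ∀ j : ℕ, 1 ≤ j → C j (powVec K p c 0) = a j • powVec K p c (extWeight p d j)

theorem HasExtCoeffs.sub_smul {lam lam' : K} {d : ℕ} {C C' : ℤ → Module.End K (Fin p → K)}
    {a a' : ℕ → K} (h : HasExtCoeffs c lam lam' d C a) (h' : HasExtCoeffs c lam lam' d C' a')
    (s : K) : HasExtCoeffs c lam lam' d (C - s • C') fun j => a j - s * a' j where
  mem := Submodule.sub_mem _ h.mem (Submodule.smul_mem _ _ h'.mem)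
  neg_one := by simp [h.neg_one, h'.neg_one]
  zero := by simp [h.zero, h'.zero]
  apply j hj := by simp [h.apply j hj, h'.apply j hj, _root_.sub_smul, mul_smul]

theorem HasExtCoeffs.eq_zero {lam lam' : K} {d : ℕ} {C : ℤ → Module.End K (Fin p → K)}
    {a : ℕ → K} (h : HasExtCoeffs c lam lam' d C a) (ha : ∀ j, 1 ≤ j → a j = 0) : C = 0 := by
  obtain ⟨h0, hC⟩ := mem_cocycles_iff_isWittCocycle.1 h.mem
  have key : ∀ n : ℕ, C ((n : ℤ) - 1) = 0 := by
    intro n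
    induction n with
    | zero => simpa using h.neg_one
    | succ n ih =>
      rcases lt_or_ge (n + 1) p with hn | hn
      · rcases Nat.eq_zero_or_pos n with rfl | hn0
        · simpa using h.zero
        have hb := hC.bracket 0 (n + 1) (by omega) hn
        rw [zero_add, Nat.add_sub_cancel, ih, smul_zero, Nat.cast_zero, zero_sub, h.neg_one,
          zero_mul, mul_zero, add_zero, zero_add, wittOp_zero, wittOp_zero] at hb
        refine eq_zero_of_commute_shiftOp (sub_eq_zero.1 hb.symm) ?_
        rw [Nat.cast_add, Nat.cast_one, add_sub_cancel_right, h.apply n hn0, ha n hn0, zero_smul]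
      · exact hC.eq_zero _ hn
  ext1 k
  rcases lt_or_ge k (-1) with h' | h'
  · exact h0 k h'
  · obtain ⟨n, rfl⟩ : ∃ n : ℕ, k = n - 1 := ⟨(k + 1).toNat, by omega⟩
    exact key n

theorem wCoef_smul_powVec_extWeight (lam : K) (d i j : ℕ) :
    wCoef K lam i (extWeight p d j) • powVec K p c (extWeight p d j - i) =
      wCoef K lam i (extWeight p d j) • powVec K p c (extWeight p d (i + j)) := by
  rcases lt_or_ge (extWeight p d j) i with h | h
  · simp [wCoef, Nat.descFactorial_eq_zero_iff_lt.2 h]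
  · congr 2
    simp only [extWeight] at h ⊢
    split_ifs at h ⊢ <;> omega

theorem HasExtCoeffs.isExtSolution [CharP K p] {lam lam' : K} {d : ℕ} (hp : 1 < p) (hd : d < p)
    {C : ℤ → Module.End K (Fin p → K)} {a : ℕ → K} (h : HasExtCoeffs c lam lam' d C a) :
    IsExtSolution p lam d a := by
  obtain ⟨h0, hC⟩ := mem_cocycles_iff_isWittCocycle.1 h.mem
  have ne (j : ℕ) : powVec K p c (extWeight p d j) ≠ 0 := powVec_ne_zero (extWeight_lt hd j)
  refine ⟨fun j hj => ?_, fun i j hi hj hip hjp => ?_⟩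
  · have := hC.eq_zero (j + 1) hj
    simp only [Nat.cast_add, Nat.cast_one, add_sub_cancel_right] at this
    rcases Nat.eq_zero_or_pos j with rfl | hj0
    · omega
    have h2 := h.apply j hj0
    rw [this, LinearMap.zero_apply] at h2
    exact (smul_eq_zero.1 h2.symm).resolve_right (ne j)
  · have hb := congrArg (fun f : Module.End K (Fin p → K) => f (powVec K p c 0))
      (hC.bracket (i + 1) (j + 1) hip hjp)
    have e : i + 1 + (j + 1) - 1 = i + j + 1 := by omega
    have hi' : i ≠ 0 := by omega
    have hj' : j ≠ 0 := by omega
    simp only [e, Nat.cast_succ, add_sub_cancel_right, LinearMap.smul_apply, LinearMap.sub_apply,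
      LinearMap.add_apply, Module.End.mul_apply, wittOp_succ_powVec_zero _ hp, if_neg hi',
      if_neg hj', map_zero, add_zero, h.apply i hi, h.apply j hj, map_smul,
      wittOp_succ_powVec_of_lt lam hip (extWeight_lt hd j),
      wittOp_succ_powVec_of_lt lam hjp (extWeight_lt hd i),
      wCoef_smul_powVec_extWeight lam d i j,
      wCoef_smul_powVec_extWeight lam d j i, add_comm j i] at hb
    rw [h.apply (i + j) (by omega), smul_smul, smul_smul, ← _root_.sub_smul,
      ← Int.cast_smul_eq_zsmul K, smul_smul] at hb
    have := smul_left_injective K (ne (i + j)) hb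
    rw [← this]
    push_cast
    ring

theorem lie_sum_choose_smul_mul_pow {A : Type} [Ring A] {x D : A} (hD : D * x - x * D = 1)
    {G : ℕ → A} (hG : ∀ n, Commute x (G n)) (n : ℕ) :
    ⁅x, ∑ k ∈ Finset.range (n + 1), ((-1) ^ k * (n.choose k : ℤ)) • (G (n - k) * D ^ k)⁆ =
      n • ∑ k ∈ Finset.range (n - 1 + 1),
        ((-1) ^ k * ((n - 1).choose k : ℤ)) • (G (n - 1 - k) * D ^ k) := by
  have hpow (k : ℕ) : ⁅x, D ^ k⁆ = -((k : ℤ) • D ^ (k - 1)) := by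
    induction k with
    | zero => simp [Ring.lie_def]
    | succ k ih =>
      have h1 : x * D = D * x - 1 := by rw [← hD]; abel
      rw [Ring.lie_def, sub_eq_iff_eq_add] at ih
      rw [Ring.lie_def, pow_succ, ← mul_assoc, ih, add_mul, mul_assoc _ x D, h1]
      rcases k with _ | k
      · simp
      · rw [Nat.add_sub_cancel, Nat.add_sub_cancel, pow_succ, mul_sub, mul_one, ← mul_assoc]
        push_cast
        simp only [add_smul, one_smul, add_mul, neg_mul, smul_mul_assoc]
        abel
  have hterm (k : ℕ) : ⁅x, G (n - k) * D ^ k⁆ = -((k : ℤ) • (G (n - k) * D ^ (k - 1))) := by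
    have := hpow k
    rw [Ring.lie_def] at this ⊢
    rw [← mul_assoc, (hG _).eq, mul_assoc, mul_assoc, ← mul_sub, this, mul_neg, mul_smul_comm]
  rw [lie_sum]
  simp only [lie_zsmul, hterm]
  rcases n with _ | n
  · simp
  rw [Finset.sum_range_succ', Nat.add_sub_cancel, Finset.smul_sum]
  simp only [Nat.cast_zero, zero_smul, neg_zero, smul_zero, add_zero, Nat.add_sub_add_right,
    Nat.add_sub_cancel]
  refine Finset.sum_congr rfl fun k _ => ?_
  have h : (((n + 1).choose (k + 1) : ℕ) : ℤ) * ((k : ℤ) + 1) = ((n : ℤ) + 1) * (n.choose k : ℕ) := by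
    exact_mod_cast (Nat.add_one_mul_choose_eq n k).symm
  rw [← natCast_zsmul, smul_neg, smul_smul, smul_smul, ← neg_smul]
  congr 1
  push_cast
  rw [pow_succ]
  linear_combination (-1) ^ k * h

theorem IsExtSolution.exists_hasExtCoeffs [CharP K p] {lam lam' : K} {d : ℕ} (hp : 2 < p)
    (hd : d < p) (hl : lam = 0 ∨ lam = -1) (hdl : (d : K) = lam - lam') {a : ℕ → K}
    (ha : IsExtSolution p lam d a) :
    ∃ C : ℤ → Module.End K (Fin p → K), HasExtCoeffs c lam lam' d C a := by
  obtain ⟨D, hD0, hD⟩ := exists_derivation (K := K) (p := p) (c := c) (by omega)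
  let G : ℕ → Module.End K (Fin p → K) := fun n =>
    if n ≤ 1 then 0 else a (n - 1) • shiftOp K p c ^ extWeight p d (n - 1)
  have hG (n : ℕ) : Commute (shiftOp K p c) (G n) := by
    simp only [G]
    split_ifs
    · exact Commute.zero_right _
    · exact ((Commute.refl _).pow_right _).smul_right _
  let S : ℕ → Module.End K (Fin p → K) := fun n =>
    ∑ k ∈ Finset.range (n + 1), ((-1) ^ k * (n.choose k : ℤ)) • (G (n - k) * D ^ k)
  have hS (n : ℕ) : ⁅shiftOp K p c, S n⁆ = n • S (n - 1) := lie_sum_choose_smul_mul_pow hD hG n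
  have hS0 (n : ℕ) : S n (powVec K p c 0) = G n (powVec K p c 0) := by
    simp only [S, LinearMap.sum_apply]
    rw [Finset.sum_eq_single 0]
    · simp
    · intro k _ hk
      obtain ⟨k, rfl⟩ := Nat.exists_eq_succ_of_ne_zero hk
      simp [pow_succ, hD0]
    · simp
  let C : ℕ → Module.End K (Fin p → K) := fun n => if n < p then S n else 0
  have hCp (n : ℕ) (hn : p ≤ n) : C n = 0 := if_neg (by omega)
  have hC0 : C 0 = 0 := by simp [C, S, G]
  have hC1 : C 1 = 0 := by simp [C, S, G, Finset.sum_range_succ]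
  have hC (n : ℕ) : ⁅shiftOp K p c, C n⁆ = n • C (n - 1) := by
    rcases lt_trichotomy n p with h | rfl | h
    · simp only [C, if_pos h, if_pos (show n - 1 < p by omega)]
      exact hS n
    · rw [hCp n le_rfl, ← Nat.cast_smul_eq_nsmul K, CharP.cast_eq_zero]
      simp
    · rw [hCp n h.le, hCp (n - 1) (by omega)]
      simp
  have hCv (n : ℕ) (hn : 1 ≤ n) : C (n + 1) (powVec K p c 0) =
      a n • powVec K p c (extWeight p d n) := by
    rcases lt_or_ge (n + 1) p with h | h
    · simp only [C, if_pos h, hS0, G, if_neg (show ¬ n + 1 ≤ 1 by omega), Nat.add_sub_cancel,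
        LinearMap.smul_apply, shiftOp_pow_powVec, zero_add]
    · rw [hCp _ h, ha.eq_zero n h]
      simp
  have hw (lam : K) := wittOp_succ_powVec_zero (p := p) (c := c) lam (by omega)
  have hv1 (n : ℕ) : (wittOp K p c lam (0 + 1) * C (n + 1) +
      C (0 + 1) * wittOp K p c lam' (n + 1) - (wittOp K p c lam (n + 1) * C (0 + 1) +
        C (n + 1) * wittOp K p c lam' (0 + 1))) (powVec K p c 0) =
      ((n : ℤ) - (0 : ℕ)) • C (0 + n + 1) (powVec K p c 0) := by
    rcases Nat.eq_zero_or_pos n with rfl | hn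
    · simp
    simp only [zero_add, hC1, zero_mul, mul_zero, add_zero]
    have h1 := hw lam' 0
    rw [zero_add, if_pos rfl] at h1
    simp only [LinearMap.sub_apply, Module.End.mul_apply, h1, map_smul, hCv n hn]
    rcases lt_or_ge n p with h | h
    · rw [wittOp_one_powVec lam (by omega) (extWeight_lt hd n), cast_extWeight h.le, hdl,
        ← Int.cast_smul_eq_zsmul K]
      push_cast
      module
    · simp [ha.eq_zero n (by omega)]
  refine ⟨fun k => if k < -1 then 0 else C (k + 1).toNat, ?_, ?_, ?_, ?_⟩
  · rw [mem_cocycles_iff_isWittCocycle]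
    refine ⟨fun k hk => if_pos hk, ?_⟩
    have e : (fun n : ℕ => if (n : ℤ) - 1 < -1 then 0 else C ((n : ℤ) - 1 + 1).toNat) = C := by
      ext1 n
      rw [if_neg (by omega)]
      simp
    rw [e]
    refine isWittCocycle_of_apply_powVec_zero (by omega) hC0 hC1 hCp hC (fun m n => ?_)
      fun n => ?_
    · rcases Nat.eq_zero_or_pos m with rfl | hm
      · exact hv1 n
      rcases Nat.eq_zero_or_pos n with rfl | hn
      · have := congrArg Neg.neg (hv1 m)
        rw [← LinearMap.neg_apply, neg_sub, zero_add, ← neg_smul, neg_sub] at this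
        simpa using this
      simp only [LinearMap.sub_apply, LinearMap.add_apply, Module.End.mul_apply, hw,
        if_neg hm.ne', if_neg hn.ne', map_zero, add_zero, hCv m hm, hCv n hn,
        hCv (m + n) (by omega), map_smul]
      rcases lt_or_ge (m + 1) p with h1 | h1
      · rcases lt_or_ge (n + 1) p with h2 | h2
        · rw [wittOp_succ_powVec_of_lt lam h1 (extWeight_lt hd n),
            wittOp_succ_powVec_of_lt lam h2 (extWeight_lt hd m),
            wCoef_smul_powVec_extWeight lam d m n, wCoef_smul_powVec_extWeight lam d n m,
            add_comm n m, smul_smul, smul_smul, ← _root_.sub_smul, ha.rel m n hm hn h1 h2,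
            mul_smul, ← Int.cast_smul_eq_zsmul K]
          push_cast
          rfl
        · simp [ha.eq_zero n h2, ha.eq_zero (m + n) (by omega),
            wittOp_eq_zero lam h2 (by omega)]
      · simp [ha.eq_zero m h1, ha.eq_zero (m + n) (by omega), wittOp_eq_zero lam h1 (by omega)]
    · rw [hCv (n + 1) (by omega), map_smul,
        wittOp_pow_pred_powVec hp hl n (extWeight_lt hd _), smul_zero]
  · simpa using hC0
  · simpa using hC1
  · intro j hj
    rw [if_neg (by omega), ← hCv j hj]
    rfl

end ExtCoefficients

section ExtDimension

variable {K : Type} [Field K] {p : ℕ} {c : K}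

theorem eq_smul_powVec [CharP K p] {t : ℕ} (ht : t < p) {v : Fin p → K}
    (h : ∀ i : Fin p, ((t : K) - (i : ℕ)) * v i = 0) : v = v ⟨t, ht⟩ • powVec K p c t := by
  rw [show powVec K p c t = Pi.single ⟨t, ht⟩ 1 from powVec_eq_single (⟨t, ht⟩ : Fin p)]
  ext i
  rcases eq_or_ne i ⟨t, ht⟩ with rfl | hi
  · simp
  · rw [Pi.smul_apply, Pi.single_eq_of_ne hi, smul_zero]
    refine (mul_eq_zero.1 (h i)).resolve_left fun h0 => hi ?_
    exact Fin.ext (CharP.natCast_injOn_Iio K p i.2 ht (sub_eq_zero.1 h0).symm)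

theorem wittOp_one_apply (lam : K) (hp : 1 < p) (u : Fin p → K) (i : Fin p) :
    wittOp K p c lam 1 u i = (lam - (i : ℕ)) * u i := by
  have : (LinearMap.proj i : (Fin p → K) →ₗ[K] K) ∘ₗ wittOp K p c lam 1 =
      (lam - (i : ℕ)) • LinearMap.proj i := by
    refine powVec_ext (c := c) fun n hn => ?_
    rw [LinearMap.comp_apply, wittOp_one_powVec lam hp hn, powVec_eq hn]
    by_cases h : (i : ℕ) = n <;> simp [h]
  simpa using LinearMap.congr_fun this u

theorem wittOp_one_pow_apply (lam : K) (hp : 1 < p) (k : ℕ) (u : Fin p → K) (i : Fin p) :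
    (wittOp K p c lam 1 ^ k) u i = (lam - (i : ℕ)) ^ k * u i := by
  induction k with
  | zero => simp
  | succ k ih => rw [pow_succ', Module.End.mul_apply, wittOp_one_apply lam hp, ih, pow_succ',
      mul_assoc]

theorem wittOp_succ_powVec_extWeight [CharP K p] (lam : K) (hp : 1 < p) {d j : ℕ} (hd : d < p) :
    wittOp K p c lam (j + 1) (powVec K p c d) =
      wCoef K lam j d • powVec K p c (extWeight p d j) := by
  have h0 : extWeight p d 0 = d := by simp [extWeight]
  rcases lt_or_ge (j + 1) p with h | h
  · rw [wittOp_succ_powVec_of_lt lam h hd]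
    have := wCoef_smul_powVec_extWeight (p := p) (c := c) lam d j 0
    rwa [h0, add_zero] at this
  · rw [wittOp_eq_zero lam h (by omega), LinearMap.zero_apply]
    rcases lt_or_ge d j with h' | h'
    · simp [wCoef, Nat.descFactorial_eq_zero_iff_lt.2 h']
    · obtain rfl : j = d := by omega
      have hjp : (j : K) + 1 = 0 := by
        rw [← Nat.cast_add_one, show j + 1 = p by omega, CharP.cast_eq_zero]
      simp [wCoef, hjp]

theorem exists_shiftOp_mul_sub_mul_eq (hp : 0 < p) {T : Module.End K (Fin p → K)}
    (hT : ∑ k ∈ Finset.range p, shiftOp K p c ^ k * T * shiftOp K p c ^ (p - 1 - k) = 0) :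
    ∃ f : Module.End K (Fin p → K), shiftOp K p c * f - f * shiftOp K p c = T := by
  let X := shiftOp K p c
  let u : ℕ → Fin p → K := fun i =>
    -∑ k ∈ Finset.range i, (X ^ (i - 1 - k)) (T (powVec K p c k))
  have hu (i : ℕ) : X (u i) - u (i + 1) = T (powVec K p c i) := by
    simp only [u, map_neg, map_sum, Nat.add_sub_cancel, Finset.sum_range_succ, Nat.sub_self,
      pow_zero, Module.End.one_apply, neg_add, sub_neg_eq_add, sub_add_eq_sub_sub]
    rw [add_eq_right, neg_add_eq_zero]
    refine Finset.sum_congr rfl fun k hk => ?_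
    rw [← Module.End.mul_apply, ← pow_succ']
    have := Finset.mem_range.1 hk
    congr 2
    omega
  have hup : u p = 0 := by
    have := LinearMap.congr_fun hT (powVec K p c 0)
    rw [← Finset.sum_range_reflect] at this
    simp only [LinearMap.sum_apply, Module.End.mul_apply, shiftOp_pow_powVec, zero_add,
      LinearMap.zero_apply] at this
    simp only [u, neg_eq_zero]
    rw [← this]
    refine Finset.sum_congr rfl fun k hk => ?_
    have := Finset.mem_range.1 hk
    rw [show p - 1 - (p - 1 - k) = k by omega]
  obtain ⟨f, hf⟩ := exists_apply_powVec (p := p) (c := c) u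
  refine ⟨f, powVec_ext (c := c) fun n hn => ?_⟩
  rw [LinearMap.sub_apply, Module.End.mul_apply, Module.End.mul_apply, shiftOp_powVec, hf n hn,
    ← hu n]
  congr 1
  rcases lt_or_ge (n + 1) p with h | h
  · exact hf _ h
  · obtain rfl : p = n + 1 := by omega
    rw [hup, powVec_self hp, map_smul, hf 0 hp]
    simp [u]

theorem exists_mem_coboundaries (hp : 0 < p) (lam lam' : K) (f : Module.End K (Fin p → K)) :
    ∃ B ∈ coboundaries K p (-1) (vermaRho K p c lam) (vermaRho K p c lam'),
      ∀ n : ℕ, B ((n : ℤ) - 1) = wittOp K p c lam n * f - f * wittOp K p c lam' n := by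
  refine ⟨fun k => if k < -1 then 0 else
    wittOp K p c lam (k + 1).toNat * f - f * wittOp K p c lam' (k + 1).toNat, ?_, fun n => ?_⟩
  · refine (mem_coboundaries_iff hp).2 ⟨fun k hk => if_pos hk, f, fun n => ?_⟩
    rw [if_neg (by omega)]
    simp
  · have : ¬ (n : ℤ) - 1 < -1 := by omega
    simp [this]

theorem commute_shiftOp_of_mem_cocycles {lam lam' : K} (hp : 1 < p)
    {C : ℤ → Module.End K (Fin p → K)}
    (hC : C ∈ cocycles K p (-1) (vermaRho K p c lam) (vermaRho K p c lam')) (h : C (-1) = 0) :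
    Commute (shiftOp K p c) (C 0) := by
  have hb := (mem_cocycles_iff_isWittCocycle.1 hC).2.bracket 0 1 (by omega) hp
  simp only [zero_add, Nat.sub_self, Nat.cast_zero, zero_sub, h, smul_zero, Nat.cast_one,
    sub_self, zero_mul, mul_zero, add_zero, wittOp_zero] at hb
  exact sub_eq_zero.1 hb.symm

theorem exists_coboundary_hasExtCoeffs [CharP K p] {lam lam' : K} {d : ℕ} (hp : 1 < p)
    (hd : d < p) (hlam : lam ^ p = lam) (hlam' : lam' ^ p = lam')
    (hdl : (d : K) = lam - lam') :
    ∃ B ∈ coboundaries K p (-1) (vermaRho K p c lam) (vermaRho K p c lam'),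
      HasExtCoeffs c lam lam' d B fun j => wCoef K lam j d := by
  obtain ⟨B, hB, h⟩ := exists_mem_coboundaries (c := c) (by omega) lam lam' (shiftOp K p c ^ d)
  have hBc := coboundaries_le_cocycles hp hlam hlam' hB
  have hB0 : B (-1) = 0 := by
    have := h 0
    rw [wittOp_zero, wittOp_zero, ← pow_succ, ← pow_succ', sub_self] at this
    simpa using this
  have hX : (shiftOp K p c ^ d) (powVec K p c 0) = powVec K p c d := by
    rw [shiftOp_pow_powVec, zero_add]
  refine ⟨B, hB, hBc, hB0, ?_, fun j hj => ?_⟩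
  · refine eq_zero_of_commute_shiftOp (commute_shiftOp_of_mem_cocycles hp hBc hB0) ?_
    have := h 1
    rw [Nat.cast_one, sub_self] at this
    rw [this, LinearMap.sub_apply, Module.End.mul_apply, Module.End.mul_apply, hX,
      wittOp_one_powVec lam hp hd, wittOp_one_powVec lam' hp (by omega), map_smul, hX, hdl]
    simp
  · have := h (j + 1)
    rw [Nat.cast_succ, add_sub_cancel_right] at this
    rw [this, LinearMap.sub_apply, Module.End.mul_apply, Module.End.mul_apply, hX,
      wittOp_succ_powVec_extWeight lam hp hd, wittOp_succ_powVec_zero lam' hp,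
      if_neg (by omega), map_zero, sub_zero]

theorem HasExtCoeffs.exists_eq_mul [CharP K p] {lam lam' : K} {d : ℕ} (hp : 1 < p)
    (hd : d < p) (hdl : (d : K) = lam - lam') {C : ℤ → Module.End K (Fin p → K)} {a : ℕ → K}
    (h : HasExtCoeffs c lam lam' d C a)
    (hC : C ∈ coboundaries K p (-1) (vermaRho K p c lam) (vermaRho K p c lam')) :
    ∃ b, ∀ j, 1 ≤ j → a j = b * wCoef K lam j d := by
  obtain ⟨-, f, hf⟩ := (mem_coboundaries_iff (by omega)).1 hC
  have hg : f (powVec K p c 0) = f (powVec K p c 0) ⟨d, hd⟩ • powVec K p c d := by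
    refine eq_smul_powVec hd fun i => ?_
    have h1 := LinearMap.congr_fun (hf 1) (powVec K p c 0)
    rw [Nat.cast_one, sub_self, h.zero, LinearMap.sub_apply, Module.End.mul_apply,
      Module.End.mul_apply, wittOp_one_powVec lam' hp (by omega), map_smul] at h1
    have h2 := congrFun h1 i
    rw [Pi.sub_apply, wittOp_one_apply lam hp] at h2
    simp only [LinearMap.zero_apply, Pi.zero_apply, Pi.smul_apply, smul_eq_mul, Nat.cast_zero,
      sub_zero] at h2
    rw [hdl]
    linear_combination -h2
  refine ⟨f (powVec K p c 0) ⟨d, hd⟩, fun j hj => ?_⟩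
  have h1 := LinearMap.congr_fun (hf (j + 1)) (powVec K p c 0)
  rw [Nat.cast_succ, add_sub_cancel_right, h.apply j hj, LinearMap.sub_apply,
    Module.End.mul_apply, Module.End.mul_apply, wittOp_succ_powVec_zero lam' hp,
    if_neg (by omega), map_zero, sub_zero, hg, map_smul, wittOp_succ_powVec_extWeight lam hp hd,
    smul_smul] at h1
  exact smul_left_injective K (powVec_ne_zero (extWeight_lt hd j)) h1

theorem exists_coboundary_sub_hasExtCoeffs [CharP K p] {lam lam' : K} {d : ℕ} (hp : 1 < p)
    (hd : d < p) (hlam : lam ^ p = lam) (hlam' : lam' ^ p = lam')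
    (hdl : (d : K) = lam - lam') {C : ℤ → Module.End K (Fin p → K)}
    (hC : C ∈ cocycles K p (-1) (vermaRho K p c lam) (vermaRho K p c lam')) :
    ∃ B ∈ coboundaries K p (-1) (vermaRho K p c lam) (vermaRho K p c lam'), ∃ a,
      HasExtCoeffs c lam lam' d (C - B) a := by
  have hle := coboundaries_le_cocycles (c := c) hp hlam hlam'
  obtain ⟨f₁, hf₁⟩ : ∃ f : Module.End K (Fin p → K),
      shiftOp K p c * f - f * shiftOp K p c = C (-1) := by
    refine exists_shiftOp_mul_sub_mul_eq (by omega) ?_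
    simpa [wittOp_zero] using (mem_cocycles_iff_isWittCocycle.1 hC).2.pchar 0 (by omega)
  obtain ⟨B₁, hB₁, h₁⟩ := exists_mem_coboundaries (c := c) (by omega) lam lam' f₁
  have hC₁ := Submodule.sub_mem _ hC (hle hB₁)
  have hC₁0 : (C - B₁) (-1) = 0 := by
    have := h₁ 0
    rw [wittOp_zero, wittOp_zero, hf₁, Nat.cast_zero, zero_sub] at this
    rw [Pi.sub_apply, this, sub_self]
  generalize hT : (C - B₁) 0 = T
  generalize hu : T (powVec K p c 0) = u
  have hud : u ⟨d, hd⟩ = 0 := by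
    have h := (mem_cocycles_iff_isWittCocycle.1 hC₁).2.pchar 1 hp
    simp only [Nat.cast_one, sub_self, hT, if_true] at h
    have h2 := congrFun (LinearMap.congr_fun h (powVec K p c 0)) ⟨d, hd⟩
    simp only [LinearMap.sum_apply, Module.End.mul_apply,
      wittOp_one_pow_powVec lam' hp (show 0 < p by omega), map_smul, hu, Finset.sum_apply,
      Pi.smul_apply, wittOp_one_pow_apply lam hp, smul_eq_mul, Nat.cast_zero, sub_zero, hdl,
      sub_sub_cancel] at h2
    rw [← h2, Finset.sum_congr rfl (g := fun _ => lam' ^ (p - 1) * u ⟨d, hd⟩)]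
    · simp
    · intro k hk
      have := Finset.mem_range.1 hk
      rw [← mul_assoc, ← pow_add, show p - 1 - k + k = p - 1 by omega]
  obtain ⟨f₂, hf₂, hf₂u⟩ := exists_commute_shiftOp (c := c)
    (fun i : Fin p => u i / (lam - (i : ℕ) - lam'))
  obtain ⟨B₂, hB₂, h₂⟩ := exists_mem_coboundaries (c := c) (by omega) lam lam' f₂
  have hC₂ := Submodule.sub_mem _ hC₁ (hle hB₂)
  have hC₂0 : (C - B₁ - B₂) (-1) = 0 := by
    have := h₂ 0
    rw [wittOp_zero, wittOp_zero, hf₂.eq, sub_self, Nat.cast_zero, zero_sub] at this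
    rw [Pi.sub_apply, this, sub_zero, hC₁0]
  have hC₂1 : (C - B₁ - B₂) 0 = 0 := by
    refine eq_zero_of_commute_shiftOp (commute_shiftOp_of_mem_cocycles hp hC₂ hC₂0) ?_
    have := h₂ 1
    rw [Nat.cast_one, sub_self] at this
    rw [Pi.sub_apply, this, hT, LinearMap.sub_apply, LinearMap.sub_apply, hu,
      Module.End.mul_apply, Module.End.mul_apply, wittOp_one_powVec lam' hp (by omega), map_smul,
      hf₂u]
    ext i
    simp only [Pi.sub_apply, wittOp_one_apply lam hp, Pi.smul_apply, smul_eq_mul, Nat.cast_zero,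
      sub_zero, Pi.zero_apply]
    rw [← sub_mul]
    by_cases h0 : lam - (i : ℕ) - lam' = 0
    · rw [h0, zero_mul, sub_zero, ← hud]
      congr 1
      refine Fin.ext (CharP.natCast_injOn_Iio K p i.2 hd ?_)
      rw [hdl]
      linear_combination -h0
    · rw [mul_div_cancel₀ _ h0, sub_self]
  rw [sub_sub] at hC₂ hC₂0 hC₂1
  refine ⟨B₁ + B₂, Submodule.add_mem _ hB₁ hB₂,
    fun j => (C - (B₁ + B₂)) j (powVec K p c 0) ⟨extWeight p d j, extWeight_lt hd j⟩,
    hC₂, hC₂0, hC₂1, fun j hj => eq_smul_powVec (extWeight_lt hd j) fun i => ?_⟩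
  have hw := (mem_cocycles_iff_isWittCocycle.1 hC₂).2
  rcases lt_or_ge (j + 1) p with h | h
  · have hb := congrFun (LinearMap.congr_fun (hw.bracket 1 (j + 1) hp h) (powVec K p c 0)) i
    simp only [sub_self, hC₂1, zero_mul, mul_zero, add_zero, zero_add,
      Nat.cast_succ, add_sub_cancel_right, LinearMap.sub_apply, LinearMap.smul_apply,
      Module.End.mul_apply, wittOp_one_powVec lam' hp (show 0 < p by omega), map_smul,
      Pi.sub_apply, wittOp_one_apply lam hp, Pi.smul_apply, smul_eq_mul, Nat.cast_zero,
      sub_zero, Nat.add_sub_cancel_left] at hb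
    rw [cast_extWeight (by omega), hdl]
    rw [zsmul_eq_mul] at hb
    push_cast at hb
    simp only [Pi.sub_apply, LinearMap.sub_apply]
    linear_combination -hb
  · have := hw.eq_zero (j + 1) h
    rw [Nat.cast_succ, add_sub_cancel_right] at this
    rw [this]
    simp

end ExtDimension

section ExtFinrank

variable {K : Type} [Field K] {p : ℕ} {c : K}

theorem finrank_extSpace_eq_zero [CharP K p] {lam lam' : K} {d : ℕ} (hp : 1 < p)
    (hd : d < p) (hlam : lam ^ p = lam) (hlam' : lam' ^ p = lam')
    (hdl : (d : K) = lam - lam')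
    (h : ∀ a, IsExtSolution p lam d a → ∃ b, ∀ j, 1 ≤ j → a j = b * wCoef K lam j d) :
    Module.finrank K (extSpace K p (-1) (vermaRho K p c lam) (vermaRho K p c lam')) = 0 := by
  have htop : Submodule.comap (cocycles K p (-1) (vermaRho K p c lam) (vermaRho K p c lam')).subtype
      (coboundaries K p (-1) (vermaRho K p c lam) (vermaRho K p c lam')) = ⊤ := by
    refine eq_top_iff.2 fun C _ => ?_
    obtain ⟨B, hB, a, ha⟩ := exists_coboundary_sub_hasExtCoeffs hp hd hlam hlam' hdl C.2
    obtain ⟨b, hb⟩ := h a (ha.isExtSolution hp hd)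
    obtain ⟨B', hB', hB'w⟩ := exists_coboundary_hasExtCoeffs (c := c) hp hd hlam hlam' hdl
    have := (ha.sub_smul hB'w b).eq_zero fun j hj => by rw [hb j hj, sub_self]
    rw [sub_sub, sub_eq_zero] at this
    rw [Submodule.mem_comap, Submodule.subtype_apply, this]
    exact Submodule.add_mem _ hB (Submodule.smul_mem _ _ hB')
  have : Subsingleton (extSpace K p (-1) (vermaRho K p c lam) (vermaRho K p c lam')) :=
    Submodule.Quotient.subsingleton_iff.2 htop
  exact Module.finrank_zero_of_subsingleton

theorem finrank_extSpace_eq_one [CharP K p] {lam lam' : K} {d : ℕ} (hp : 2 < p)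
    (hd : d < p) (hlam : lam ^ p = lam) (hlam' : lam' ^ p = lam') (hl : lam = 0 ∨ lam = -1)
    (hdl : (d : K) = lam - lam') {z : ℕ → K} (hz : IsExtSolution p lam d z)
    (hz' : ¬ ∃ b, ∀ j, 1 ≤ j → z j = b * wCoef K lam j d)
    (h : ∀ a, IsExtSolution p lam d a →
      ∃ s b, ∀ j, 1 ≤ j → a j = s * z j + b * wCoef K lam j d) :
    Module.finrank K (extSpace K p (-1) (vermaRho K p c lam) (vermaRho K p c lam')) = 1 := by
  obtain ⟨Z, hZ⟩ := hz.exists_hasExtCoeffs (c := c) hp hd hl hdl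
  rw [finrank_eq_one_iff']
  refine ⟨Submodule.Quotient.mk ⟨Z, hZ.mem⟩, fun h0 => ?_, fun w => ?_⟩
  · rw [Submodule.Quotient.mk_eq_zero] at h0
    exact hz' (hZ.exists_eq_mul (by omega) hd hdl h0)
  · obtain ⟨C, rfl⟩ := Submodule.Quotient.mk_surjective _ w
    obtain ⟨B, hB, a, ha⟩ :=
      exists_coboundary_sub_hasExtCoeffs (by omega) hd hlam hlam' hdl C.2
    obtain ⟨s, b, hsb⟩ := h a (ha.isExtSolution (by omega) hd)
    obtain ⟨B', hB', hB'w⟩ :=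
      exists_coboundary_hasExtCoeffs (c := c) (by omega) hd hlam hlam' hdl
    have := ((ha.sub_smul hZ s).sub_smul hB'w b).eq_zero fun j hj => by rw [hsb j hj]; ring
    refine ⟨s, ?_⟩
    rw [← Submodule.Quotient.mk_smul, eq_comm, Submodule.Quotient.eq, Submodule.mem_comap]
    have e : (C : ℤ → Module.End K (Fin p → K)) - s • Z = B + b • B' := by
      rw [← sub_eq_zero, ← this]
      abel
    simp only [map_sub, map_smul, Submodule.subtype_apply]
    rw [e]
    exact Submodule.add_mem _ hB (Submodule.smul_mem _ _ hB')

end ExtFinrank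

section ExtSolution

variable {K : Type} [Field K] {p : ℕ}

theorem wCoef_eq_zero_of_lt (lam : K) {i m : ℕ} (h : m < i) : wCoef K lam i m = 0 := by
  simp [wCoef, Nat.descFactorial_eq_zero_iff_lt.2 h]

theorem wCoef_one (lam : K) (m : ℕ) : wCoef K lam 1 m = m * (m - (2 * lam + 1)) := by
  simp only [wCoef, Nat.descFactorial_one, pow_one, Nat.cast_one]
  ring

theorem wCoef_one_extWeight [CharP K p] (lam : K) {d j : ℕ} (hj : j ≤ p) :
    wCoef K lam 1 (extWeight p d j) = ((d : K) - j) * (d - j - (2 * lam + 1)) := by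
  rw [wCoef_one, cast_extWeight hj]

theorem isExtSolution_of_lt {lam : K} {d : ℕ} {a : ℕ → K} (h0 : ∀ j, p ≤ j + 1 → a j = 0)
    (h : ∀ i j, 1 ≤ i → i < j → j + 1 < p →
      a j * wCoef K lam i (extWeight p d j) - a i * wCoef K lam j (extWeight p d i) =
        ((j : K) - i) * a (i + j)) : IsExtSolution p lam d a := by
  refine ⟨h0, fun i j hi hj hip hjp => ?_⟩
  rcases lt_trichotomy i j with hij | rfl | hij
  · exact h i j hi hij hjp
  · simp
  · have := h j i hj hij hip
    rw [add_comm j i] at this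
    linear_combination -this

theorem isExtSolution_of_forall_le {lam : K} {d : ℕ} {a : ℕ → K}
    (h0 : ∀ j, p ≤ j + 1 → a j = 0) (hd : ∀ j, d < j → a j = 0)
    (h : ∀ i j, 1 ≤ i → i < j → j ≤ d →
      a j * wCoef K lam i (d - j) - a i * wCoef K lam j (d - i) =
        ((j : K) - i) * a (i + j)) : IsExtSolution p lam d a := by
  refine isExtSolution_of_lt h0 fun i j hi hij hj => ?_
  rcases le_or_gt j d with hjd | hjd
  · rw [extWeight, extWeight, if_pos hjd, if_pos (by omega)]
    exact h i j hi hij hjd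
  · rw [hd j hjd, hd (i + j) (by omega), zero_mul, mul_zero, zero_sub, neg_eq_zero]
    rcases le_or_gt i d with hid | hid
    · rw [extWeight, if_pos hid, wCoef_eq_zero_of_lt lam (by omega), mul_zero]
    · rw [hd i hid, zero_mul]

theorem IsExtSolution.sub_smul {lam : K} {d : ℕ} {a z : ℕ → K} (ha : IsExtSolution p lam d a)
    (hz : IsExtSolution p lam d z) (s : K) : IsExtSolution p lam d fun j => a j - s * z j where
  eq_zero j hj := by rw [ha.eq_zero j hj, hz.eq_zero j hj, mul_zero, sub_zero]
  rel i j hi hj hip hjp := by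
    linear_combination ha.rel i j hi hj hip hjp - s * hz.rel i j hi hj hip hjp

theorem natCast_ne_zero_of_lt [CharP K p] {n : ℕ} (h0 : 0 < n) (hn : n < p) : (n : K) ≠ 0 := by
  rw [Ne, CharP.cast_eq_zero_iff K p]
  exact Nat.not_dvd_of_pos_of_lt h0 hn

theorem IsExtSolution.rel_one {lam : K} {d : ℕ} {a : ℕ → K} (ha : IsExtSolution p lam d a)
    (h1 : a 1 = 0) {j : ℕ} (hj : 1 ≤ j) (hjp : j + 1 < p) :
    a j * wCoef K lam 1 (extWeight p d j) = ((j : K) - 1) * a (j + 1) := by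
  have := ha.rel 1 j le_rfl hj (by omega) hjp
  rwa [h1, zero_mul, sub_zero, Nat.cast_one, add_comm 1 j] at this

theorem IsExtSolution.eq_zero_of_one_of_two [CharP K p] {lam : K} {d : ℕ} {a : ℕ → K}
    (ha : IsExtSolution p lam d a) (h1 : a 1 = 0) (h2 : a 2 = 0) {j : ℕ} (hj : 1 ≤ j) :
    a j = 0 := by
  rcases hj.eq_or_lt with rfl | hj
  · exact h1
  induction j, (show 2 ≤ j from hj) using Nat.le_induction with
  | base => exact h2
  | succ j hj2 ih =>
    rcases lt_or_ge (j + 1) p with h | h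
    · have := ha.rel_one h1 (by omega) h
      rw [ih (by omega) (by omega), zero_mul, eq_comm] at this
      refine (mul_eq_zero.1 this).resolve_left ?_
      have := natCast_ne_zero_of_lt (K := K) (show 0 < j - 1 by omega) (show j - 1 < p by omega)
      rwa [Nat.cast_sub (by omega), Nat.cast_one] at this
    · exact ha.eq_zero _ (by omega)

theorem IsExtSolution.eq_zero_of_one {lam : K} {d : ℕ} {a : ℕ → K}
    (ha : IsExtSolution p lam d a) (h1 : a 1 = 0)
    (hw : ∀ j, 2 ≤ j → j + 1 < p → wCoef K lam 1 (extWeight p d j) ≠ 0) {j : ℕ} (hj : 1 ≤ j) :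
    a j = 0 := by
  rcases hj.eq_or_lt with rfl | hj
  · exact h1
  obtain ⟨n, hn⟩ : ∃ n, p ≤ j + 1 + n := ⟨p, by omega⟩
  induction n generalizing j with
  | zero => exact ha.eq_zero j hn
  | succ n ih =>
    rcases lt_or_ge (j + 1) p with h | h
    · have := ha.rel_one h1 (by omega) h
      rw [ih (j := j + 1) (by omega) (by omega) (by omega), mul_zero] at this
      exact (mul_eq_zero.1 this).resolve_right (hw j hj h)
    · exact ha.eq_zero j h

theorem isExtSolution_wCoef [CharP K p] {lam : K} {d : ℕ} (hp : 1 < p) (hd : d < p)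
    (hlam : lam ^ p = lam) : IsExtSolution p lam d fun j => wCoef K lam j d := by
  have : Fact p.Prime := ⟨(CharP.char_is_prime_or_zero K p).resolve_right (by omega)⟩
  obtain ⟨B, -, hB⟩ := exists_coboundary_hasExtCoeffs (K := K) (p := p) (c := 0)
    (lam' := lam - d) hp hd hlam (by rw [sub_pow_char, hlam, ← frobenius_def, map_natCast])
    (by ring)
  exact hB.isExtSolution hp hd

theorem IsExtSolution.exists_eq_mul [CharP K p] {lam : K} {d : ℕ} (hp : 1 < p) (hd : d < p)
    (hlam : lam ^ p = lam) (hw : wCoef K lam 1 d ≠ 0)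
    (h : ∀ a, IsExtSolution p lam d a → a 1 = 0 → a 2 = 0) {a : ℕ → K}
    (ha : IsExtSolution p lam d a) : ∃ b, ∀ j, 1 ≤ j → a j = b * wCoef K lam j d := by
  have hs := ha.sub_smul (isExtSolution_wCoef hp hd hlam) (a 1 / wCoef K lam 1 d)
  have h1 : a 1 - a 1 / wCoef K lam 1 d * wCoef K lam 1 d = 0 := by
    rw [div_mul_cancel₀ _ hw, sub_self]
  exact ⟨_, fun j hj => sub_eq_zero.1 (hs.eq_zero_of_one_of_two h1 (h _ hs h1) hj)⟩

section

variable {c : K}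

theorem finrank_extSpace_eq_one_of_wCoef_ne_zero [CharP K p] {lam lam' : K} {d : ℕ} (hp : 2 < p)
    (hd : d < p) (hlam : lam ^ p = lam) (hlam' : lam' ^ p = lam') (hl : lam = 0 ∨ lam = -1)
    (hdl : (d : K) = lam - lam') (hw : wCoef K lam 1 d ≠ 0) {z : ℕ → K}
    (hz : IsExtSolution p lam d z) (hz1 : z 1 = 0) (hz2 : z 2 = 1) :
    Module.finrank K (extSpace K p (-1) (vermaRho K p c lam) (vermaRho K p c lam')) = 1 := by
  refine finrank_extSpace_eq_one hp hd hlam hlam' hl hdl hz ?_ fun a ha => ?_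
  · rintro ⟨b, hb⟩
    have h1 := hb 1 le_rfl
    have h2 := hb 2 (by omega)
    rw [hz1, eq_comm] at h1
    rw [(mul_eq_zero.1 h1).resolve_right hw, hz2, zero_mul] at h2
    exact one_ne_zero h2
  · let b := a 1 / wCoef K lam 1 d
    refine ⟨a 2 - b * wCoef K lam 2 d, b, fun j hj => ?_⟩
    have hs := (ha.sub_smul (isExtSolution_wCoef (by omega) hd hlam) b).sub_smul hz
      (a 2 - b * wCoef K lam 2 d)
    have := hs.eq_zero_of_one_of_two (by simp [b, hz1, div_mul_cancel₀ _ hw]) (by simp [hz2]) hj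
    linear_combination this

theorem finrank_extSpace_eq_one_of_wCoef_eq_zero [CharP K p] {lam lam' : K} {d : ℕ} (hp : 2 < p)
    (hd : d < p) (hlam : lam ^ p = lam) (hlam' : lam' ^ p = lam') (hl : lam = 0 ∨ lam = -1)
    (hdl : (d : K) = lam - lam') (hw : wCoef K lam 1 d = 0)
    (hw' : ∀ j, 2 ≤ j → j + 1 < p → wCoef K lam 1 (extWeight p d j) ≠ 0) {z : ℕ → K}
    (hz : IsExtSolution p lam d z) (hz1 : z 1 ≠ 0) :
    Module.finrank K (extSpace K p (-1) (vermaRho K p c lam) (vermaRho K p c lam')) = 1 := by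
  refine finrank_extSpace_eq_one hp hd hlam hlam' hl hdl hz ?_ fun a ha => ?_
  · rintro ⟨b, hb⟩
    exact hz1 (by rw [hb 1 le_rfl, hw, mul_zero])
  · refine ⟨a 1 / z 1, 0, fun j hj => ?_⟩
    have := (ha.sub_smul hz (a 1 / z 1)).eq_zero_of_one
      (by rw [div_mul_cancel₀ _ hz1, sub_self]) hw' hj
    linear_combination this

end

theorem neg_one_pow_mul_descFactorial_mul_factorial {m j : ℕ} (h : (m : K) = -(j + 1)) (i : ℕ) :
    (-1 : K) ^ i * (m.descFactorial i : K) * (j.factorial : K) = ((i + j).factorial : K) := by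
  induction i with
  | zero => simp
  | succ i ih =>
    have hs : ((m.descFactorial (i + 1) : ℕ) : K) = ((m : K) - i) * m.descFactorial i := by
      rcases le_or_gt i m with him | him
      · rw [Nat.descFactorial_succ, Nat.cast_mul, Nat.cast_sub him]
      · rw [Nat.descFactorial_succ, Nat.descFactorial_eq_zero_iff_lt.2 him]
        simp
    rw [hs, h, show i + 1 + j = (i + j) + 1 by ring, Nat.factorial_succ, Nat.cast_mul, ← ih]
    push_cast
    ring

theorem isExtSolution_factorial [CharP K p] {lam : K} {d : ℕ} (hp : 0 < p)
    (h : lam = 0 ∧ d = 0 ∨ lam = -1 ∧ d = p - 1) :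
    IsExtSolution p lam d fun j => ((j + 1).factorial : K) := by
  have h0 (j : ℕ) (hj : p ≤ j) : (j.factorial : K) = 0 := by
    rw [CharP.cast_eq_zero_iff K p]
    exact Nat.dvd_factorial hp hj
  have key (i j : ℕ) (hj : 1 ≤ j) (hjp : j + 1 < p) :
      ((j + 1).factorial : K) * wCoef K lam i (extWeight p d j) =
        j * (j + 1) * ((i + j).factorial : K) := by
    have hm := cast_extWeight (K := K) (p := p) (d := d) (j := j) (by omega)
    rcases h with ⟨rfl, rfl⟩ | ⟨rfl, rfl⟩
    · obtain ⟨k, rfl⟩ := Nat.exists_eq_add_of_le' hj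
      have := neg_one_pow_mul_descFactorial_mul_factorial (m := extWeight p 0 (k + 1)) (j := k)
        (by rw [hm]; push_cast; ring) i
      rw [wCoef, hm, ← add_assoc i, Nat.factorial_succ, Nat.factorial_succ k,
        Nat.factorial_succ (i + k), Nat.cast_mul, Nat.cast_mul, Nat.cast_mul _ (Nat.factorial (i + k)),
        ← this]
      push_cast
      ring
    · rw [Nat.cast_sub (by omega), CharP.cast_eq_zero K p, Nat.cast_one, zero_sub] at hm
      have := neg_one_pow_mul_descFactorial_mul_factorial (m := extWeight p (p - 1) j) (j := j)
        (by rw [hm]; ring) i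
      rw [wCoef, hm, Nat.factorial_succ, Nat.cast_mul, ← this]
      push_cast
      ring
  refine ⟨fun j hj => h0 _ hj, fun i j hi hj hip hjp => ?_⟩
  rw [key i j hj hjp, key j i hi hip, add_comm j i, Nat.factorial_succ (i + j)]
  push_cast
  ring

theorem IsExtSolution.two_eq_zero [CharP K p] {lam : K} {d : ℕ} (hp : 3 < p)
    (h : lam = 0 ∧ 6 ≤ d ∧ d < p ∨ lam = -1 ∧ 5 ≤ d ∧ d + 1 < p) {a : ℕ → K}
    (ha : IsExtSolution p lam d a) (h1 : a 1 = 0) : a 2 = 0 := by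
  have h12 := ha.rel_one h1 (j := 2) (by omega) (by omega)
  have h13 := ha.rel_one h1 (j := 3) (by omega) (by omega)
  have h14 := ha.rel_one h1 (j := 4) (by omega) (by omega)
  have h23 := ha.rel 2 3 (by omega) (by omega) (by omega) (by omega)
  obtain ⟨e, rfl⟩ := Nat.exists_eq_add_of_le' (show 5 ≤ d by omega)
  have e2 : extWeight p (e + 5) 2 = e + 3 := by rw [extWeight, if_pos (by omega)]; rfl
  have e3 : extWeight p (e + 5) 3 = e + 2 := by rw [extWeight, if_pos (by omega)]; rfl
  have e4 : extWeight p (e + 5) 4 = e + 1 := by rw [extWeight, if_pos (by omega)]; rfl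
  rw [e2, wCoef_one] at h12
  rw [e3, wCoef_one] at h13
  rw [e4, wCoef_one] at h14
  have d3 : (e + 3).descFactorial 3 = (e + 3) * (e + 2) * (e + 1) := by
    simp [Nat.descFactorial_succ]
    ring
  have d2 : (e + 2).descFactorial 2 = (e + 2) * (e + 1) := by
    simp [Nat.descFactorial_succ]
    ring
  rw [e2, e3, wCoef, wCoef, d2, d3] at h23
  push_cast at h12 h13 h14 h23
  have ne (k : ℕ) (h0 : 0 < k) (hk : k < p) := natCast_ne_zero_of_lt (K := K) h0 hk
  have n0 (h : 0 < e) := ne e h (by omega)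
  have n1 := ne (e + 1) (by omega) (by omega)
  have n2 := ne (e + 2) (by omega) (by omega)
  have n3 := ne (e + 3) (by omega) (by omega)
  have n4 := ne (e + 4) (by omega) (by omega)
  have n5 := ne (e + 5) (by omega) (by omega)
  have n6 (h : e + 6 < p) := ne (e + 6) (by omega) h
  push_cast at n1 n2 n3 n4 n5 n6
  rcases h with ⟨rfl, h6, hdp⟩ | ⟨rfl, h5, hdp⟩
  · have : a 2 * (((e : K) + 5) * (e + 4) * (e + 3) * (e + 2) * (e + 1) * e) = 0 := by
      linear_combination (((e : K) + 2) * (e + 1) * (e + 1) * e + 6 * (e + 2) * (e + 1) * e) * h12 +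
        (e + 1) * e * h13 + 2 * h14 - 6 * h23
    refine (mul_eq_zero.1 this).resolve_right ?_
    simp [n0 (by omega), n1, n2, n3, n4, n5]
  · have : a 2 * (((e : K) + 6) * (e + 5) * (e + 4) * (e + 3) * (e + 2) * (e + 1)) = 0 := by
      linear_combination
        (((e : K) + 2) * (e + 3) * (e + 1) * (e + 2) + 6 * (e + 2) * (e + 1) * (e + 3)) * h12 +
          (e + 1) * (e + 2) * h13 + 2 * h14 - 6 * h23
    refine (mul_eq_zero.1 this).resolve_right ?_
    simp [n6 (by omega), n1, n2, n3, n4, n5]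

end ExtSolution

section ExtClassification

variable {K : Type} [Field K] {p : ℕ} {c : K}

theorem finrank_extSpace_of_eq_zero [CharP K p] {lam' : K} {d : ℕ} (hp : 3 < p)
    (hd : d < p) (hlam' : lam' ^ p = lam') (hdl : (d : K) = 0 - lam') :
    Module.finrank K (extSpace K p (-1) (vermaRho K p c 0) (vermaRho K p c lam')) =
      if d ≤ 5 then 1 else 0 := by
  have hprime : p.Prime := (CharP.char_is_prime_or_zero K p).resolve_right (by omega)
  have hp4 : p ≠ 4 := by rintro rfl; exact absurd hprime (by decide)
  have hp6 : p ≠ 6 := by rintro rfl; exact absurd hprime (by decide)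
  have h0 : (0 : K) ^ p = 0 := zero_pow (by omega)
  have hw (h2 : 2 ≤ d) : wCoef K 0 1 d ≠ 0 := by
    rw [wCoef_one]
    have h1 := natCast_ne_zero_of_lt (K := K) (n := d) (by omega) hd
    have h2 := natCast_ne_zero_of_lt (K := K) (n := d - 1) (by omega) (by omega)
    rw [Nat.cast_sub (by omega), Nat.cast_one] at h2
    simp [h1, h2]
  split_ifs with h5
  · have hA {z : ℕ → K} (h2 : 2 ≤ d) (hz : IsExtSolution p 0 d z) (hz1 : z 1 = 0)
        (hz2 : z 2 = 1) := finrank_extSpace_eq_one_of_wCoef_ne_zero (c := c) (by omega) hd h0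
      hlam' (Or.inl rfl) hdl (hw h2) hz hz1 hz2
    interval_cases d
    · refine finrank_extSpace_eq_one_of_wCoef_eq_zero (by omega) hd h0 hlam' (Or.inl rfl) hdl
        (by simp [wCoef_one]) (fun j hj hjp => ?_)
        (isExtSolution_factorial (by omega) (Or.inl ⟨rfl, rfl⟩)) ?_
      · rw [wCoef_one_extWeight _ (by omega)]
        have h1 := natCast_ne_zero_of_lt (K := K) (n := j) (by omega) (by omega)
        have h2 := natCast_ne_zero_of_lt (K := K) (n := j + 1) (by omega) (by omega)
        rw [Nat.cast_succ] at h2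
        have : ((0 : ℕ) - j : K) * ((0 : ℕ) - j - (2 * 0 + 1)) = j * (j + 1) := by
          push_cast
          ring
        rw [this]
        exact mul_ne_zero h1 h2
      · exact natCast_ne_zero_of_lt (n := 2) (by omega) (by omega)
    · refine finrank_extSpace_eq_one_of_wCoef_eq_zero (by omega) hd h0 hlam' (Or.inl rfl) hdl
        (by simp [wCoef_one]) (fun j hj hjp => ?_)
        (z := fun j => if j = 1 then 1 else 0)
        (isExtSolution_of_forall_le (fun j hj => if_neg (by omega))
          (fun j hj => if_neg (by omega)) fun i j hi hij hj => by omega) (by simp)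
      rw [wCoef_one_extWeight _ (by omega)]
      have h1 := natCast_ne_zero_of_lt (K := K) (n := j) (by omega) (by omega)
      have h2 := natCast_ne_zero_of_lt (K := K) (n := j - 1) (by omega) (by omega)
      rw [Nat.cast_sub (by omega), Nat.cast_one] at h2
      have : ((1 : ℕ) - j : K) * ((1 : ℕ) - j - (2 * 0 + 1)) = j * (j - 1) := by
        push_cast
        ring
      rw [this]
      exact mul_ne_zero h1 h2
    · refine hA (z := fun j => if j = 2 then 1 else 0) le_rfl (isExtSolution_of_forall_le
        (fun j hj => if_neg (by omega)) (fun j hj => if_neg (by omega)) fun i j hi hij hj => ?_)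
        rfl rfl
      obtain ⟨rfl, rfl⟩ : i = 1 ∧ j = 2 := by omega
      norm_num [wCoef, Nat.descFactorial]
    · refine hA (z := fun j => if j = 2 then 1 else 0) (by omega) (isExtSolution_of_forall_le
        (fun j hj => if_neg (by omega)) (fun j hj => if_neg (by omega)) fun i j hi hij hj => ?_)
        rfl rfl
      interval_cases j <;> interval_cases i <;> norm_num [wCoef, Nat.descFactorial]
    · refine hA (z := fun j => if j = 2 then 1 else if j = 3 then 2 else 0) (by omega)
        (isExtSolution_of_forall_le
        (fun j hj => by simp (disch := omega) only [if_neg])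
        (fun j hj => by simp (disch := omega) only [if_neg]) fun i j hi hij hj => ?_) rfl rfl
      interval_cases j <;> interval_cases i <;> norm_num [wCoef, Nat.descFactorial]
    · refine hA (z := fun j => if j = 2 then 1 else if j = 3 then 6 else if j = 4 then 6 else 0)
        (by omega) (isExtSolution_of_forall_le
        (fun j hj => by simp (disch := omega) only [if_neg])
        (fun j hj => by simp (disch := omega) only [if_neg]) fun i j hi hij hj => ?_) rfl rfl
      interval_cases j <;> interval_cases i <;> norm_num [wCoef, Nat.descFactorial]
  · exact finrank_extSpace_eq_zero (by omega) hd h0 hlam' hdl fun a ha =>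
      ha.exists_eq_mul (by omega) hd h0 (hw (by omega)) fun a ha h1 =>
        ha.two_eq_zero hp (Or.inl ⟨rfl, by omega, hd⟩) h1

theorem finrank_extSpace_of_eq_neg_one [CharP K p] {lam' : K} {d : ℕ} (hp : 3 < p)
    (hd : d < p) (hlam' : lam' ^ p = lam') (hdl : (d : K) = -1 - lam') :
    Module.finrank K (extSpace K p (-1) (vermaRho K p c (-1)) (vermaRho K p c lam')) =
      if d ≤ 4 ∨ d = p - 1 then 1 else 0 := by
  have hprime : p.Prime := (CharP.char_is_prime_or_zero K p).resolve_right (by omega)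
  have hp4 : p ≠ 4 := by rintro rfl; exact absurd hprime (by decide)
  have hp6 : p ≠ 6 := by rintro rfl; exact absurd hprime (by decide)
  have h0 : (-1 : K) ^ p = -1 := (hprime.odd_of_ne_two (by omega)).neg_one_pow
  have hw (h1 : 1 ≤ d) (h2 : d ≠ p - 1) : wCoef K (-1) 1 d ≠ 0 := by
    rw [wCoef_one]
    have h1 := natCast_ne_zero_of_lt (K := K) (n := d) (by omega) hd
    have h2 := natCast_ne_zero_of_lt (K := K) (n := d + 1) (by omega) (by omega)
    rw [Nat.cast_succ] at h2
    refine mul_ne_zero h1 ?_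
    convert h2 using 1
    ring
  rcases eq_or_ne d (p - 1) with rfl | hdp
  · rw [if_pos (Or.inr rfl)]
    have hc : ((p - 1 : ℕ) : K) = -1 := by
      rw [Nat.cast_sub (by omega), CharP.cast_eq_zero, Nat.cast_one, zero_sub]
    refine finrank_extSpace_eq_one_of_wCoef_eq_zero (by omega) hd h0 hlam' (Or.inr rfl) hdl
      (wCoef_neg_one_pred (by omega) 1) (fun j hj hjp => ?_)
      (isExtSolution_factorial (by omega) (Or.inr ⟨rfl, rfl⟩)) ?_
    · rw [wCoef_one_extWeight _ (by omega), hc]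
      have h1 := natCast_ne_zero_of_lt (K := K) (n := j) (by omega) (by omega)
      have h2 := natCast_ne_zero_of_lt (K := K) (n := j + 1) (by omega) (by omega)
      rw [Nat.cast_succ] at h2
      have : (-1 - j : K) * (-1 - j - (2 * (-1) + 1)) = j * (j + 1) := by ring
      rw [this]
      exact mul_ne_zero h1 h2
    · exact natCast_ne_zero_of_lt (n := 2) (by omega) (by omega)
  simp only [hdp, or_false]
  split_ifs with h4
  · have hA {z : ℕ → K} (h1 : 1 ≤ d) (hz : IsExtSolution p (-1) d z) (hz1 : z 1 = 0)
        (hz2 : z 2 = 1) := finrank_extSpace_eq_one_of_wCoef_ne_zero (c := c) (by omega) hd h0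
      hlam' (Or.inr rfl) hdl (hw h1 hdp) hz hz1 hz2
    interval_cases d
    · refine finrank_extSpace_eq_one_of_wCoef_eq_zero (by omega) hd h0 hlam' (Or.inr rfl) hdl
        (by simp [wCoef_one]) (fun j hj hjp => ?_)
        (z := fun j => if j = 1 then 1 else 0)
        (isExtSolution_of_lt (fun j hj => if_neg (by omega)) fun i j hi hij hj => ?_) (by simp)
      · rw [wCoef_one_extWeight _ (by omega)]
        have h1 := natCast_ne_zero_of_lt (K := K) (n := j) (by omega) (by omega)
        have h2 := natCast_ne_zero_of_lt (K := K) (n := j - 1) (by omega) (by omega)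
        rw [Nat.cast_sub (by omega), Nat.cast_one] at h2
        have : ((0 : ℕ) - j : K) * ((0 : ℕ) - j - (2 * (-1) + 1)) = j * (j - 1) := by
          push_cast
          ring
        rw [this]
        exact mul_ne_zero h1 h2
      · have hj1 : j ≠ 1 := by omega
        rw [if_neg hj1, if_neg (by omega : i + j ≠ 1)]
        rcases hi.eq_or_lt with rfl | hi
        · simp [extWeight, wCoef_neg_one_pred (show 0 < p by omega)]
        · simp [hi.ne']
    · refine hA (z := fun j => if j = 2 then 1 else 0) le_rfl (isExtSolution_of_lt
        (fun j hj => if_neg (by omega)) fun i j hi hij hj => ?_) rfl rfl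
      have e : extWeight p 1 2 = p - 1 := by rw [extWeight, if_neg (by omega)]; omega
      have h2 (i : ℕ) := wCoef_neg_one_pred (K := K) (p := p) (by omega) i
      rw [if_neg (by omega : i + j ≠ 2)]
      rcases eq_or_ne j 2 with rfl | hj2
      · simp [e, h2, hij.ne]
      rcases eq_or_ne i 2 with rfl | hi2
      · simp [e, h2, hj2]
      simp [hi2, hj2]
    · refine hA (z := fun j => if j = 2 then 1 else 0) (by omega) (isExtSolution_of_forall_le
        (fun j hj => if_neg (by omega)) (fun j hj => if_neg (by omega)) fun i j hi hij hj => ?_)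
        rfl rfl
      obtain ⟨rfl, rfl⟩ : i = 1 ∧ j = 2 := by omega
      norm_num [wCoef, Nat.descFactorial]
    · refine hA (z := fun j => if j = 2 then 1 else if j = 3 then 2 else 0) (by omega)
        (isExtSolution_of_forall_le
        (fun j hj => by simp (disch := omega) only [if_neg])
        (fun j hj => by simp (disch := omega) only [if_neg]) fun i j hi hij hj => ?_) rfl rfl
      interval_cases j <;> interval_cases i <;> norm_num [wCoef, Nat.descFactorial]
    · refine hA (z := fun j => if j = 2 then 1 else if j = 3 then 6 else if j = 4 then 6 else 0)
        (by omega) (isExtSolution_of_forall_le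
        (fun j hj => by simp (disch := omega) only [if_neg])
        (fun j hj => by simp (disch := omega) only [if_neg]) fun i j hi hij hj => ?_) rfl rfl
      interval_cases j <;> interval_cases i <;> norm_num [wCoef, Nat.descFactorial]
  · exact finrank_extSpace_eq_zero (by omega) hd h0 hlam' hdl fun a ha =>
      ha.exists_eq_mul (by omega) hd h0 (hw (by omega) hdp) fun a ha h1 =>
        ha.two_eq_zero hp (Or.inr ⟨rfl, by omega, by omega⟩) h1

theorem exists_natCast_eq_of_pow_eq [CharP K p] (hp : 0 < p) {x : K} (hx : x ^ p = x) :
    ∃ d < p, (d : K) = x := by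
  have : Fact p.Prime := ⟨(CharP.char_is_prime_or_zero K p).resolve_right (by omega)⟩
  have hmem := (Subfield.mem_bot_iff_pow_eq_self K p).2 hx
  rw [← ZMod.fieldRange_castHom_eq_bot p] at hmem
  obtain ⟨z, rfl⟩ := hmem
  exact ⟨z.val, z.val_lt, ZMod.natCast_val z⟩

end ExtClassification

open scoped Classical in
/-- If `χ` has height `-1`, `0` or `1`, `λ, λ' ∈ Λ(χ)` and `λ ∈ {0, p-1}`, then
`Ext(V_χ(λ'), V_χ(λ)) ≅ K` if `λ' ∈ {0, p-1, p-2, p-3, p-4, p-5}` and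
`Ext(V_χ(λ'), V_χ(λ)) = 0` otherwise. -/
theorem ext_verma_verma_of_lambda_mem
    (K : Type) [Field K] [IsAlgClosed K] (p : ℕ) [CharP K p] (hp : 3 < p)
    (chi : ℤ → K) (hsupp : ∀ k : ℤ, (k < -1 ∨ (p : ℤ) - 2 < k) → chi k = 0)
    (hheight : ∀ k : ℤ, 1 ≤ k → chi k = 0)
    (lam lam' : K)
    (hlam : lam ^ p - lam = chi 0 ^ p) (hlam' : lam' ^ p - lam' = chi 0 ^ p)
    (hl : lam = 0 ∨ lam = (p : K) - 1) :
    Module.finrank K (extSpace K p (-1)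
        (vermaRho K p (chi (-1) ^ p) lam) (vermaRho K p (chi (-1) ^ p) lam'))
      = if lam' = 0 ∨ lam' = (p : K) - 1 ∨ lam' = (p : K) - 2 ∨ lam' = (p : K) - 3 ∨
            lam' = (p : K) - 4 ∨ lam' = (p : K) - 5
        then 1 else 0 := by
  have hpK : (p : K) = 0 := CharP.cast_eq_zero K p
  have hprime : p.Prime := (CharP.char_is_prime_or_zero K p).resolve_right (by omega)
  have hl' : lam = 0 ∨ lam = -1 := by simpa [hpK] using hl
  have h0 : lam ^ p = lam := by
    rcases hl' with rfl | rfl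
    · exact zero_pow (by omega)
    · exact (hprime.odd_of_ne_two (by omega)).neg_one_pow
  have h0' : lam' ^ p = lam' := by
    rwa [← hlam, h0, sub_self, sub_eq_zero] at hlam'
  obtain ⟨d, hd, hdl⟩ := exists_natCast_eq_of_pow_eq (K := K) (p := p) (by omega)
    (x := lam - lam') (by
      have : Fact p.Prime := ⟨hprime⟩
      rw [sub_pow_char, h0, h0'])
  have hinj (k : ℕ) (hk : k < p) (h : (d : K) = k) : d = k :=
    CharP.natCast_injOn_Iio K p hd hk h
  rw [hpK]
  rcases hl' with rfl | rfl
  · obtain rfl : lam' = -(d : K) := by rw [hdl]; ring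
    rw [finrank_extSpace_of_eq_zero hp hd h0' hdl]
    refine if_congr ⟨fun h => ?_, fun h => ?_⟩ rfl rfl
    · interval_cases d <;> simp
    · by_contra h5
      rcases h with h | h | h | h | h | h
      · exact h5 (by rw [hinj 0 (by omega) (by push_cast; linear_combination -h)]; omega)
      · exact h5 (by rw [hinj 1 (by omega) (by push_cast; linear_combination -h)]; omega)
      · exact h5 (by rw [hinj 2 (by omega) (by push_cast; linear_combination -h)]; omega)
      · exact h5 (by rw [hinj 3 (by omega) (by push_cast; linear_combination -h)]; omega)
      · exact h5 (by rw [hinj 4 (by omega) (by push_cast; linear_combination -h)]; omega)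
      · exact h5 (by rw [hinj 5 (by omega) (by push_cast; linear_combination -h)])
  · obtain rfl : lam' = -1 - (d : K) := by rw [hdl]; ring
    rw [finrank_extSpace_of_eq_neg_one hp hd h0' hdl]
    refine if_congr ⟨fun h => ?_, fun h => ?_⟩ rfl rfl
    · rcases h with h | rfl
      · interval_cases d <;> norm_num
      · left
        rw [Nat.cast_sub (by omega), hpK]
        simp
    · by_contra h5
      rcases h with h | h | h | h | h | h
      · have := hinj (p - 1) (by omega)
          (by rw [Nat.cast_sub (by omega), hpK]; push_cast; linear_combination -h)
        omega
      · have := hinj 0 (by omega) (by push_cast; linear_combination -h)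
        omega
      · have := hinj 1 (by omega) (by push_cast; linear_combination -h)
        omega
      · have := hinj 2 (by omega) (by push_cast; linear_combination -h)
        omega
      · have := hinj 3 (by omega) (by push_cast; linear_combination -h)
        omega
      · have := hinj 4 (by omega) (by push_cast; linear_combination -h)
        omega
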